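/- arXiv:1612.01315 — 4 statements merged into one kernel-verified Lean document; each statement's English description precedes it below -/
import Mathlib

section
/- Let A be a rational map of the Riemann sphere of degree m ≥ 2 and let O be an orbifold on ℂP¹ with signature {2, 2, n} for some n > 2 (exactly three singular points, with ν-values 2, 2, and n), such that A : O → O is a minimal holomorphic map between orbifolds. Then m ≥ n + 1, unless A is conjugate to T_m or to −T_m. -/
open Polynomial OnePoint
open scoped Classical

noncomputable section

namespace GenLattes

/-- Composition of rational functions: `rcomp f g = f ∘ g`. -/
def rcomp (f g : RatFunc ℂ) : RatFunc ℂ :=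
  Polynomial.aeval g f.num / Polynomial.aeval g f.denom

/-- The degree of a rational function: the maximum of the degrees of its numerator and
denominator in lowest terms. -/
def rdeg (f : RatFunc ℂ) : ℕ := max f.num.natDegree f.denom.natDegree

/-- Evaluation of a rational function at a finite point, with value in the Riemann
sphere `ℂP¹ = OnePoint ℂ`. -/
def evalF (f : RatFunc ℂ) (z : ℂ) : OnePoint ℂ :=
  if f.denom.eval z = 0 then ∞ else ((f.num.eval z / f.denom.eval z : ℂ) : OnePoint ℂ)

/-- The local degree (local multiplicity) of a rational function at a finite point. -/
def locDegF (f : RatFunc ℂ) (z : ℂ) : ℕ :=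
  if f.denom.eval z = 0 then rootMultiplicity z f.denom
  else rootMultiplicity z (f.num - Polynomial.C (f.num.eval z / f.denom.eval z) * f.denom)

/-- The rational function `f(1/X)`. -/
def flip (f : RatFunc ℂ) : RatFunc ℂ := rcomp f (RatFunc.X)⁻¹

/-- The self-map of the Riemann sphere `ℂP¹ = OnePoint ℂ` induced by a rational function. -/
def evalOP (f : RatFunc ℂ) (x : OnePoint ℂ) : OnePoint ℂ :=
  OnePoint.rec (evalF (flip f) 0) (fun z => evalF f z) x

/-- The local degree `deg_x f` of a rational function at a point of the Riemann sphere. -/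
def locDeg (f : RatFunc ℂ) (x : OnePoint ℂ) : ℕ :=
  OnePoint.rec (locDegF (flip f) 0) (fun z => locDegF f z) x

/-- The iterate `f^{∘l}` of a rational function (with `riter f 0 = X = id`). -/
def riter (f : RatFunc ℂ) : ℕ → RatFunc ℂ
  | 0 => RatFunc.X
  | l + 1 => rcomp f (riter f l)

/-- An orbifold on the Riemann sphere: a ramification function `ν : ℂP¹ → ℕ` with
`ν(z) ≥ 1` everywhere and `ν(z) = 1` outside a finite set. -/
structure Orbifold where
  nu : OnePoint ℂ → ℕ
  one_le : ∀ z, 1 ≤ nu z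
  finite : {z : OnePoint ℂ | nu z ≠ 1}.Finite

/-- A good orbifold: it is forbidden to have exactly one point with `ν > 1`, or exactly
two such points with different values of `ν`. -/
def Orbifold.Good (O : Orbifold) : Prop :=
  (¬ ∃ z, {w : OnePoint ℂ | O.nu w ≠ 1} = {z}) ∧
  (¬ ∃ z₁ z₂, z₁ ≠ z₂ ∧ {w : OnePoint ℂ | O.nu w ≠ 1} = {z₁, z₂} ∧ O.nu z₁ ≠ O.nu z₂)

/-- A nontrivial orbifold (distinct from the non-ramified sphere). -/
def Orbifold.IsNontrivial (O : Orbifold) : Prop := ∃ z, 1 < O.nu z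

/-- The relation `O₁ ⪯ O₂`: pointwise divisibility of ramification functions. -/
def Orbifold.Prec (O₁ O₂ : Orbifold) : Prop := ∀ z, O₁.nu z ∣ O₂.nu z

/-- The signature of an orbifold: the multiset of values of `ν` on `c(O) = {ν > 1}`. -/
def Orbifold.signature (O : Orbifold) : Multiset ℕ := O.finite.toFinset.val.map O.nu

/-- The Euler characteristic `χ(O) = 2 + Σ (1/ν(z) - 1)`. -/
def Orbifold.eulerChar (O : Orbifold) : ℚ :=
  2 + ∑ z ∈ O.finite.toFinset, ((O.nu z : ℚ)⁻¹ - 1)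

/-- `A : O₁ → O₂` is a holomorphic map between orbifolds:
`ν₂(A(z)) ∣ ν₁(z)·deg_z A` for all `z`. -/
def IsHolo (A : RatFunc ℂ) (O₁ O₂ : Orbifold) : Prop :=
  ∀ z, O₂.nu (evalOP A z) ∣ O₁.nu z * locDeg A z

/-- `A : O₁ → O₂` is a minimal holomorphic map between orbifolds:
`ν₂(A(z)) = ν₁(z)·gcd(deg_z A, ν₂(A(z)))` for all `z`. -/
def IsMinHolo (A : RatFunc ℂ) (O₁ O₂ : Orbifold) : Prop :=
  ∀ z, O₂.nu (evalOP A z) = O₁.nu z * Nat.gcd (locDeg A z) (O₂.nu (evalOP A z))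

/-- `A : O₁ → O₂` is a covering map between orbifolds:
`ν₂(A(z)) = ν₁(z)·deg_z A` for all `z`. -/
def IsCovering (A : RatFunc ℂ) (O₁ O₂ : Orbifold) : Prop :=
  ∀ z, O₂.nu (evalOP A z) = O₁.nu z * locDeg A z

/-- `A` and `B` are conjugate by a Möbius transformation: `A = μ ∘ B ∘ μ⁻¹`. -/
def Conjugate (A B : RatFunc ℂ) : Prop :=
  ∃ μ ν : RatFunc ℂ, rcomp μ ν = RatFunc.X ∧ rcomp ν μ = RatFunc.X ∧
    A = rcomp (rcomp μ B) ν

/-- The Chebyshev polynomial `T_d` viewed as a rational function. -/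
def chebyRF (d : ℕ) : RatFunc ℂ :=
  algebraMap (Polynomial ℂ) (RatFunc ℂ) (Polynomial.Chebyshev.T ℂ d)

end GenLattes

namespace GenLattes

/-- One descent step for the polynomial Pell equation lowers the degree. -/
lemma natDegree_pell_descent {P R : ℂ[X]} {j : ℕ} (hP : P.natDegree = j + 1)
    (hR : R.natDegree = j) (hlead : R.leadingCoeff = P.leadingCoeff)
    (h : P ^ 2 - 1 = (X ^ 2 - 1) * R ^ 2) :
    (X * P - (X ^ 2 - 1) * R).natDegree < j + 1 := by
  have hP0 : P ≠ 0 := by rintro rfl; simp at hP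
  have hc : (X * P + (X ^ 2 - 1) * R).coeff (j + 2) ≠ 0 := by
    have e : (X * P + (X ^ 2 - 1) * R).coeff (j + 2) = P.coeff (j + 1) + R.coeff j := by
      rw [sub_mul, coeff_add, coeff_sub, coeff_X_mul, coeff_X_pow_mul, one_mul,
        coeff_eq_zero_of_natDegree_lt (p := R) (n := j + 2) (by omega), sub_zero]
    have h1 : P.coeff (j + 1) = P.leadingCoeff := by rw [leadingCoeff, hP]
    have h2 : R.coeff j = P.leadingCoeff := by rw [← hlead, leadingCoeff, hR]
    rw [e, h1, h2, ← two_mul]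
    exact mul_ne_zero two_ne_zero (leadingCoeff_ne_zero.2 hP0)
  have hd := le_natDegree_of_ne_zero hc
  have hs0 : X * P + (X ^ 2 - 1) * R ≠ 0 := by
    intro h0; rw [h0] at hc; simp at hc
  have hprod : (X * P - (X ^ 2 - 1) * R) * (X * P + (X ^ 2 - 1) * R) = P ^ 2 + (X ^ 2 - 1) := by
    linear_combination (X ^ 2 - 1) * h
  by_cases h0 : X * P - (X ^ 2 - 1) * R = 0
  · rw [h0]; simp
  have hm := natDegree_mul h0 hs0
  have hle : (P ^ 2 + (X ^ 2 - 1 : ℂ[X])).natDegree ≤ 2 * (j + 1) := by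
    refine natDegree_add_le_of_degree_le ?_ ?_
    · rw [natDegree_pow, hP]
    · refine (natDegree_sub_le _ _).trans ?_
      simp
  rw [hprod] at hm
  omega

/-- Up to signs, the solutions of the polynomial Pell equation are the Chebyshev polynomials. -/
lemma pell_eq_chebyshev (m : ℕ) : ∀ P R : ℂ[X], P.natDegree = m →
    P ^ 2 - 1 = (X ^ 2 - 1) * R ^ 2 →
    (P = Chebyshev.T ℂ m ∨ P = -Chebyshev.T ℂ m) ∧
      (R = Chebyshev.U ℂ (m - 1) ∨ R = -Chebyshev.U ℂ (m - 1)) := by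
  induction m using Nat.strong_induction_on with
  | _ m ih =>
  intro P R hP h
  have hX : (X ^ 2 - 1 : ℂ[X]).natDegree = 2 := natDegree_X_pow_sub_C (n := 2) (r := (1 : ℂ))
  have hX0 : (X ^ 2 - 1 : ℂ[X]) ≠ 0 := by
    intro h0; rw [h0] at hX; simp at hX
  have hXl : (X ^ 2 - 1 : ℂ[X]).leadingCoeff = 1 := by
    rw [← C_1]; exact leadingCoeff_X_pow_sub_C (by norm_num)
  rcases m with _ | j
  · obtain ⟨a, rfl⟩ := natDegree_eq_zero.1 hP
    have hR : R = 0 := by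
      by_contra hR
      have := congrArg natDegree h
      rw [natDegree_mul hX0 (pow_ne_zero 2 hR), hX, ← C_pow, ← C_1, ← C_sub, natDegree_C] at this
      omega
    subst hR
    have ha : a ^ 2 = 1 := by
      have : C (a ^ 2) = (C 1 : ℂ[X]) := by
        rw [C_pow, C_1]; linear_combination h
      exact C_injective this
    refine ⟨?_, by simp⟩
    rcases (by simpa using ha : a = 1 ∨ a = -1) with rfl | rfl <;> simp
  have hP2 : (P ^ 2 - 1).natDegree = 2 * (j + 1) := by
    rw [← C_1, natDegree_sub_C, natDegree_pow, hP]
  have hR0 : R ≠ 0 := by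
    rintro rfl
    rw [h] at hP2; simp at hP2
  have hR : R.natDegree = j := by
    rw [h, natDegree_mul hX0 (pow_ne_zero 2 hR0), hX, natDegree_pow] at hP2
    omega
  have hl : R.leadingCoeff ^ 2 = P.leadingCoeff ^ 2 := by
    have := congrArg leadingCoeff h
    rw [leadingCoeff_mul, leadingCoeff_pow, hXl, one_mul, leadingCoeff_sub_of_degree_lt,
      leadingCoeff_pow] at this
    · exact this.symm
    · rw [degree_pow, degree_eq_natDegree (show P ≠ 0 by rintro rfl; simp at hP), hP]
      exact degree_one_le.trans_lt (by rw [nsmul_eq_mul]; norm_cast; omega)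
  have key : ∀ R : ℂ[X], R.natDegree = j → R.leadingCoeff = P.leadingCoeff →
      P ^ 2 - 1 = (X ^ 2 - 1) * R ^ 2 →
      (P = Chebyshev.T ℂ ((j + 1 : ℕ) : ℤ) ∨ P = -Chebyshev.T ℂ ((j + 1 : ℕ) : ℤ)) ∧
      (R = Chebyshev.U ℂ ((j + 1 : ℕ) - 1 : ℤ) ∨ R = -Chebyshev.U ℂ ((j + 1 : ℕ) - 1 : ℤ)) := by
    intro R hR hlead h
    have hlt := natDegree_pell_descent hP hR hlead h
    have hpell : (X * P - (X ^ 2 - 1) * R) ^ 2 - 1 = (X ^ 2 - 1) * (X * R - P) ^ 2 := by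
      linear_combination h
    obtain ⟨h1, h2⟩ := ih _ hlt _ _ rfl hpell
    set k := (X * P - (X ^ 2 - 1) * R).natDegree
    have eP : P = X * (X * P - (X ^ 2 - 1) * R) + (X ^ 2 - 1) * (X * R - P) := by ring
    have eR : R = X * (X * R - P) + (X * P - (X ^ 2 - 1) * R) := by ring
    have eT : Chebyshev.T ℂ (k + 1 : ℤ) = X * Chebyshev.T ℂ k +
        (X ^ 2 - 1) * Chebyshev.U ℂ (k - 1) := by
      have := Chebyshev.T_eq_X_mul_T_sub_pol_U ℂ (k - 1)
      rw [show (k : ℤ) - 1 + 2 = k + 1 by ring, show (k : ℤ) - 1 + 1 = k by ring] at this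
      rw [this]; ring
    have eU : Chebyshev.U ℂ (k : ℤ) = X * Chebyshev.U ℂ (k - 1) + Chebyshev.T ℂ k := by
      have := Chebyshev.U_eq_X_mul_U_add_T ℂ (k - 1)
      rwa [show (k : ℤ) - 1 + 1 = k by ring] at this
    have eT' : Chebyshev.T ℂ (k - 1 : ℤ) = X * Chebyshev.T ℂ k -
        (X ^ 2 - 1) * Chebyshev.U ℂ (k - 1) := by
      have := Chebyshev.T_sub_one ℂ k
      rw [this, eT]; ring
    have dT (i : ℤ) : (Chebyshev.T ℂ i).natDegree = i.natAbs := Chebyshev.natDegree_T ℂ i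
    have hcase : ((X * P - (X ^ 2 - 1) * R = Chebyshev.T ℂ k ∧
          X * R - P = Chebyshev.U ℂ (k - 1)) ∨
        (X * P - (X ^ 2 - 1) * R = -Chebyshev.T ℂ k ∧
          X * R - P = -Chebyshev.U ℂ (k - 1))) := by
      rcases Nat.eq_zero_or_pos k with h0 | hpos
      · have hu : Chebyshev.U ℂ ((k : ℤ) - 1) = 0 := by rw [h0]; simp
        rw [hu] at h2 ⊢
        rw [neg_zero, or_self] at h2
        simpa [h2] using h1
      · have hbad : P ≠ Chebyshev.T ℂ (k - 1 : ℤ) ∧ P ≠ -Chebyshev.T ℂ (k - 1 : ℤ) := by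
          constructor
          · intro e
            have := dT (k - 1); rw [← e, hP] at this; omega
          · intro e
            have := dT (k - 1); rw [← natDegree_neg, ← e, hP] at this; omega
        rcases h1 with h1 | h1 <;> rcases h2 with h2 | h2
        · exact Or.inl ⟨h1, h2⟩
        · exact absurd (by rw [eP, h1, h2, eT']; ring) hbad.1
        · exact absurd (by rw [eP, h1, h2, eT']; ring) hbad.2
        · exact Or.inr ⟨h1, h2⟩
    have hkj : k = j := by
      have hd := dT (k + 1)
      rcases hcase with ⟨h1, h2⟩ | ⟨h1, h2⟩
      · rw [h1, h2, ← eT] at eP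
        rw [← eP, hP] at hd; omega
      · rw [h1, h2] at eP
        rw [show Chebyshev.T ℂ (k + 1 : ℤ) = -P by rw [eP, eT]; ring, natDegree_neg, hP] at hd
        omega
    have e1 : ((j + 1 : ℕ) : ℤ) = k + 1 := by rw [hkj]; simp
    rw [e1, add_sub_cancel_right]
    rcases hcase with ⟨h1, h2⟩ | ⟨h1, h2⟩
    · exact ⟨Or.inl (by rw [eP, h1, h2, eT]), Or.inl (by rw [eR, h1, h2, eU])⟩
    · exact ⟨Or.inr (by rw [eP, h1, h2, eT]; ring), Or.inr (by rw [eR, h1, h2, eU]; ring)⟩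
  rcases sq_eq_sq_iff_eq_or_eq_neg.1 hl with hl | hl
  · exact key R hR hl h
  · have := key (-R) (by rwa [natDegree_neg]) (by rw [leadingCoeff_neg, hl, neg_neg])
      (by rw [h]; ring)
    refine ⟨this.1, ?_⟩
    rcases this.2 with h2 | h2
    · exact Or.inr (by rw [← h2, neg_neg])
    · exact Or.inl (neg_injective h2)

/-- The polynomial `P - w Q`, or `Q` when `w = ∞`, whose roots are the finite solutions
of `P / Q = w`. -/
def fiberPoly (P Q : ℂ[X]) (w : OnePoint ℂ) : ℂ[X] :=
  OnePoint.rec Q (fun w => P - C w * Q) w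

@[simp] lemma fiberPoly_infty (P Q : ℂ[X]) : fiberPoly P Q ∞ = Q := rfl

@[simp] lemma fiberPoly_coe (P Q : ℂ[X]) (w : ℂ) : fiberPoly P Q w = P - C w * Q := rfl

lemma fiberPoly_mul_left (R P Q : ℂ[X]) (w : OnePoint ℂ) :
    fiberPoly (R * P) (R * Q) w = R * fiberPoly P Q w := by
  induction w using OnePoint.rec with
  | infty => simp
  | coe w => simp; ring

/-- The order of vanishing at a point of the Riemann sphere of a polynomial `G`,
viewed as a binary form of degree `m`. -/
def formOrder (m : ℕ) (G : ℂ[X]) (z : OnePoint ℂ) : ℕ :=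
  OnePoint.rec (m - G.natDegree) (fun z => rootMultiplicity z G) z

@[simp] lemma formOrder_infty (m : ℕ) (G : ℂ[X]) : formOrder m G ∞ = m - G.natDegree := rfl

@[simp] lemma formOrder_coe (m : ℕ) (G : ℂ[X]) (z : ℂ) :
    formOrder m G z = rootMultiplicity z G := rfl

lemma exists_fiberPoly_eq_C_mul {P Q : ℂ[X]} (h : IsCoprime P Q) (hQ : Q ≠ 0) {f : RatFunc ℂ}
    (hf : f = algebraMap ℂ[X] (RatFunc ℂ) P / algebraMap ℂ[X] (RatFunc ℂ) Q) :
    ∃ a : ℂ, a ≠ 0 ∧ ∀ w, fiberPoly P Q w = C a * fiberPoly f.num f.denom w := by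
  have hmul : f.num * Q = P * f.denom := (RatFunc.num_mul_eq_mul_denom_iff hQ).2 hf
  obtain ⟨u, hu⟩ : f.denom ∣ Q := hf ▸ RatFunc.denom_div_dvd P Q
  have hP : P = f.num * u := by
    apply mul_right_cancel₀ f.denom_ne_zero
    rw [← hmul, hu]; ring
  have hun : IsUnit u := h.isUnit_of_dvd' ⟨f.num, by rw [hP]; ring⟩ ⟨f.denom, by rw [hu]; ring⟩
  obtain ⟨a, ha, rfl⟩ := Polynomial.isUnit_iff.1 hun
  refine ⟨a, ha.ne_zero, fun w => ?_⟩
  rw [← fiberPoly_mul_left, ← mul_comm f.num, ← mul_comm f.denom, ← hP, ← hu]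

lemma rootMultiplicity_C_mul {a : ℂ} (ha : a ≠ 0) (G : ℂ[X]) (z : ℂ) :
    rootMultiplicity z (C a * G) = rootMultiplicity z G := by
  by_cases hG : G = 0
  · simp [hG]
  rw [rootMultiplicity_mul (mul_ne_zero (C_ne_zero.2 ha) hG), rootMultiplicity_C, zero_add]

lemma eval_fiberPoly_eq_zero_iff (f : RatFunc ℂ) (z : ℂ) (w : OnePoint ℂ) :
    (fiberPoly f.num f.denom w).eval z = 0 ↔ evalF f z = w := by
  have hcop : f.num.eval z ≠ 0 ∨ f.denom.eval z ≠ 0 := by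
    obtain ⟨a, b, hab⟩ := f.isCoprime_num_denom
    by_contra! hc
    have := congrArg (Polynomial.eval z) hab
    simp [hc.1, hc.2] at this
  rw [evalF]
  split_ifs with h
  · have h1 : f.num.eval z ≠ 0 := hcop.resolve_right (not_not.2 h)
    induction w using OnePoint.rec with
    | infty => simp [h]
    | coe w => simp [h, h1, OnePoint.infty_ne_coe]
  · induction w using OnePoint.rec with
    | infty => simp [h]
    | coe w => simp [sub_eq_zero, div_eq_iff h]

lemma locDegF_eq (f : RatFunc ℂ) (z : ℂ) :
    locDegF f z = rootMultiplicity z (fiberPoly f.num f.denom (evalF f z)) := by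
  rw [locDegF, evalF]
  split_ifs with h
  · rfl
  · rfl

lemma evalF_div_eq_iff {P Q : ℂ[X]} (h : IsCoprime P Q) (hQ : Q ≠ 0) (z : ℂ) (w : OnePoint ℂ) :
    evalF (algebraMap ℂ[X] (RatFunc ℂ) P / algebraMap ℂ[X] (RatFunc ℂ) Q) z = w ↔
      (fiberPoly P Q w).eval z = 0 := by
  obtain ⟨a, ha, hPQ⟩ := exists_fiberPoly_eq_C_mul h hQ rfl
  rw [← eval_fiberPoly_eq_zero_iff, hPQ, eval_mul, eval_C, mul_eq_zero, or_iff_right ha]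

lemma locDegF_div {P Q : ℂ[X]} (h : IsCoprime P Q) (hQ : Q ≠ 0) (z : ℂ) :
    locDegF (algebraMap ℂ[X] (RatFunc ℂ) P / algebraMap ℂ[X] (RatFunc ℂ) Q) z =
      rootMultiplicity z (fiberPoly P Q
        (evalF (algebraMap ℂ[X] (RatFunc ℂ) P / algebraMap ℂ[X] (RatFunc ℂ) Q) z)) := by
  obtain ⟨a, ha, hPQ⟩ := exists_fiberPoly_eq_C_mul h hQ rfl
  rw [locDegF_eq, hPQ, rootMultiplicity_C_mul ha]

lemma isCoprime_reflect {P Q : ℂ[X]} (h : IsCoprime P Q) {m : ℕ}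
    (hP : P.natDegree ≤ m) (hQ : Q.natDegree ≤ m) (hm : P.natDegree = m ∨ Q.natDegree = m) :
    IsCoprime (reflect m P) (reflect m Q) := by
  rw [isCoprime_iff_aeval_ne_zero_of_isAlgClosed ℂ ℂ]
  intro r
  simp only [coe_aeval_eq_eval]
  by_cases hr : r = 0
  · subst hr
    simp only [← coeff_zero_eq_eval_zero, coeff_reflect, revAt_le (Nat.zero_le m), Nat.sub_zero]
    by_contra! hc
    have hz : ∀ F : ℂ[X], F.natDegree = m → F.coeff m = 0 → F = 0 := by
      rintro F rfl hF
      exact leadingCoeff_eq_zero.1 hF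
    rcases hm with hm | hm
    · have hP0 := hz P hm hc.1
      subst hP0
      have hu : IsUnit Q := isCoprime_zero_left.1 h
      have : m = 0 := by simpa using hm.symm
      subst this
      have hQ0 := hz Q (by omega) hc.2
      simp [hQ0] at hu
    · have hQ0 := hz Q hm hc.2
      subst hQ0
      have hu : IsUnit P := isCoprime_zero_right.1 h
      have : m = 0 := by simpa using hm.symm
      subst this
      have hP0 := hz P (by omega) hc.1
      simp [hP0] at hu
  · let : Invertible r⁻¹ := invertibleOfNonzero (inv_ne_zero hr)
    have hinv : ⅟(r⁻¹) = r := by rw [invOf_eq_inv, inv_inv]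
    have e (F : ℂ[X]) (hF : F.natDegree ≤ m) : (reflect m F).eval r = 0 ↔ F.eval r⁻¹ = 0 := by
      have := eval₂_reflect_eq_zero_iff (RingHom.id ℂ) r⁻¹ m F hF
      rwa [hinv] at this
    rw [Ne, Ne, e P hP, e Q hQ]
    obtain ⟨a, b, hab⟩ := h
    by_contra! hc
    have := congrArg (Polynomial.eval r⁻¹) hab
    simp [hc.1, hc.2] at this

lemma flip_eq_reflect_div (f : RatFunc ℂ) :
    flip f = algebraMap ℂ[X] (RatFunc ℂ) (reflect (rdeg f) f.num) /
      algebraMap ℂ[X] (RatFunc ℂ) (reflect (rdeg f) f.denom) := by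
  have hX : (RatFunc.X : RatFunc ℂ)⁻¹ ≠ 0 := inv_ne_zero RatFunc.X_ne_zero
  let : Invertible (RatFunc.X : RatFunc ℂ)⁻¹ := invertibleOfNonzero hX
  have hinv : ⅟((RatFunc.X : RatFunc ℂ)⁻¹) = RatFunc.X := by rw [invOf_eq_inv, inv_inv]
  have e (F : ℂ[X]) (hF : F.natDegree ≤ rdeg f) : aeval (RatFunc.X : RatFunc ℂ)⁻¹ F =
      algebraMap ℂ[X] (RatFunc ℂ) (reflect (rdeg f) F) * (RatFunc.X : RatFunc ℂ)⁻¹ ^ rdeg f := by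
    rw [aeval_def, ← eval₂_reflect_mul_pow _ _ (rdeg f) F hF, hinv, ← aeval_def,
      ← RatFunc.algebraMap_X, aeval_algebraMap_apply, aeval_X_left_apply]
  rw [flip, rcomp, e _ (le_max_left _ _), e _ (le_max_right _ _),
    mul_div_mul_right _ _ (pow_ne_zero _ hX)]

lemma reflect_fiberPoly (m : ℕ) (P Q : ℂ[X]) (w : OnePoint ℂ) :
    fiberPoly (reflect m P) (reflect m Q) w = reflect m (fiberPoly P Q w) := by
  induction w using OnePoint.rec with
  | infty => simp
  | coe w => simp [reflect_sub, reflect_C_mul]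

lemma natDegree_fiberPoly_le {P Q : ℂ[X]} {m : ℕ} (hP : P.natDegree ≤ m) (hQ : Q.natDegree ≤ m)
    (w : OnePoint ℂ) : (fiberPoly P Q w).natDegree ≤ m := by
  induction w using OnePoint.rec with
  | infty => simpa
  | coe w => simpa using natDegree_sub_le_of_le hP ((natDegree_C_mul_le w _).trans hQ)

lemma rootMultiplicity_zero_reflect {m : ℕ} {G : ℂ[X]} (hG : G ≠ 0) (hm : G.natDegree ≤ m) :
    rootMultiplicity 0 (reflect m G) = m - G.natDegree := by
  have hr : reflect m G ≠ 0 := by simpa using hG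
  rw [rootMultiplicity_eq_natTrailingDegree, C_0, add_zero, comp_X]
  apply le_antisymm
  · apply natTrailingDegree_le_of_ne_zero
    rw [coeff_reflect, revAt_le (Nat.sub_le _ _), Nat.sub_sub_self hm]
    simpa using hG
  · apply le_natTrailingDegree hr
    intro i hi
    rw [coeff_reflect, revAt_le (by omega)]
    exact coeff_eq_zero_of_natDegree_lt (by omega)

section LocalDegree

variable {A : RatFunc ℂ}

lemma fiberPoly_num_denom_ne_zero (hA : 1 ≤ rdeg A) (w : OnePoint ℂ) :
    fiberPoly A.num A.denom w ≠ 0 := by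
  induction w using OnePoint.rec with
  | infty => exact A.denom_ne_zero
  | coe w =>
    intro h
    rw [fiberPoly_coe, sub_eq_zero] at h
    have hu : IsUnit A.denom := A.isCoprime_num_denom.isUnit_of_dvd' ⟨C w, by rw [h]; ring⟩ dvd_rfl
    have h1 := natDegree_eq_zero_of_isUnit hu
    have h2 := natDegree_C_mul_le w A.denom
    rw [← h] at h2
    simp only [rdeg] at hA
    omega

lemma natDegree_fiberPoly_num_denom_le (A : RatFunc ℂ) (w : OnePoint ℂ) :
    (fiberPoly A.num A.denom w).natDegree ≤ rdeg A :=
  natDegree_fiberPoly_le (le_max_left _ _) (le_max_right _ _) w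

lemma evalOP_eq_iff (hA : 1 ≤ rdeg A) (z w : OnePoint ℂ) :
    evalOP A z = w ↔ 0 < formOrder (rdeg A) (fiberPoly A.num A.denom w) z := by
  have hG := fiberPoly_num_denom_ne_zero hA w
  induction z using OnePoint.rec with
  | coe z =>
    rw [formOrder_coe, rootMultiplicity_pos hG, IsRoot, eval_fiberPoly_eq_zero_iff]
    rfl
  | infty =>
    have hcop := isCoprime_reflect A.isCoprime_num_denom (m := rdeg A) (le_max_left _ _)
      (le_max_right _ _) (by rw [rdeg]; omega)
    have hQ : reflect (rdeg A) A.denom ≠ 0 := by simpa using A.denom_ne_zero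
    change evalF (flip A) 0 = w ↔ _
    rw [flip_eq_reflect_div, evalF_div_eq_iff hcop hQ, reflect_fiberPoly, formOrder_infty,
      ← rootMultiplicity_zero_reflect hG (natDegree_fiberPoly_num_denom_le A w),
      rootMultiplicity_pos (by simpa using hG), IsRoot]

lemma locDeg_eq_formOrder (hA : 1 ≤ rdeg A) (z : OnePoint ℂ) :
    locDeg A z = formOrder (rdeg A) (fiberPoly A.num A.denom (evalOP A z)) z := by
  have hG := fiberPoly_num_denom_ne_zero hA (evalOP A z)
  induction z using OnePoint.rec with
  | coe z => exact locDegF_eq A z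
  | infty =>
    have hcop := isCoprime_reflect A.isCoprime_num_denom (m := rdeg A) (le_max_left _ _)
      (le_max_right _ _) (by rw [rdeg]; omega)
    have hQ : reflect (rdeg A) A.denom ≠ 0 := by simpa using A.denom_ne_zero
    rw [formOrder_infty, ← rootMultiplicity_zero_reflect hG (natDegree_fiberPoly_num_denom_le A _)]
    change locDegF (flip A) 0 = rootMultiplicity 0 (reflect (rdeg A)
      (fiberPoly A.num A.denom (evalF (flip A) 0)))
    rw [flip_eq_reflect_div, locDegF_div hcop hQ, reflect_fiberPoly]

lemma exists_fiber_sum (hA : 1 ≤ rdeg A) (w : OnePoint ℂ) :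
    ∃ S : Finset (OnePoint ℂ), (∀ z, z ∈ S ↔ evalOP A z = w) ∧ ∑ z ∈ S, locDeg A z = rdeg A := by
  classical
  set G := fiberPoly A.num A.denom w with hGdef
  have hG : G ≠ 0 := fiberPoly_num_denom_ne_zero hA w
  set T : Finset (OnePoint ℂ) := insert ∞ (G.roots.toFinset.map ⟨_, OnePoint.coe_injective⟩)
  have hT : ∑ z ∈ T, formOrder (rdeg A) G z = rdeg A := by
    rw [Finset.sum_insert (by simp), Finset.sum_map, formOrder_infty]
    have hs : ∑ x ∈ G.roots.toFinset, rootMultiplicity x G = G.natDegree := by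
      rw [← splits_iff_card_roots.1 (IsAlgClosed.splits G),
        ← Multiset.toFinset_sum_count_eq]
      simp
    have hle : G.natDegree ≤ rdeg A := natDegree_fiberPoly_num_denom_le A w
    simp only [Function.Embedding.coeFn_mk, formOrder_coe, hs]
    omega
  refine ⟨T.filter (fun z => evalOP A z = w), fun z => ?_, ?_⟩
  · rw [Finset.mem_filter, and_iff_right_iff_imp]
    intro hz
    induction z using OnePoint.rec with
    | infty => simp [T]
    | coe z =>
      rw [evalOP_eq_iff hA, formOrder_coe, rootMultiplicity_pos hG] at hz
      simp only [T, Finset.mem_insert, Finset.mem_map, Multiset.mem_toFinset]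
      exact Or.inr ⟨z, (mem_roots hG).2 hz, rfl⟩
  · rw [Finset.sum_filter]
    refine Eq.trans (Finset.sum_congr rfl fun z _ => ?_) hT
    split_ifs with h
    · rw [locDeg_eq_formOrder hA, h]
    · rw [evalOP_eq_iff hA, ← hGdef] at h
      omega

end LocalDegree

/-- For a minimal self-map of an orbifold of signature `{2, 2, n}`, either the degree exceeds `n`,
or the point of index `n` is totally invariant and the points of index `2` are permuted
or collapsed among themselves. -/
lemma degree_bound_or_invariant {α : Type*} {e : α → α} {d ν : α → ℕ} {m n : ℕ} {z₁ z₂ z₃ : α}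
    (hn : 2 < n) (h12 : z₁ ≠ z₂) (h13 : z₁ ≠ z₃) (h23 : z₂ ≠ z₃)
    (h₁ : ν z₁ = 2) (h₂ : ν z₂ = 2) (h₃ : ν z₃ = n)
    (hother : ∀ z, z ≠ z₁ → z ≠ z₂ → z ≠ z₃ → ν z = 1)
    (hmin : ∀ z, ν (e z) = ν z * Nat.gcd (d z) (ν (e z)))
    (hd : ∀ z, 1 ≤ d z)
    (hfib : ∀ w, ∃ S : Finset α, (∀ z, z ∈ S ↔ e z = w) ∧ ∑ z ∈ S, d z = m) :
    n + 1 ≤ m ∨ ((e z₁ = z₁ ∨ e z₁ = z₂) ∧ (e z₂ = z₁ ∨ e z₂ = z₂) ∧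
      ∀ z, e z = z₃ ↔ z = z₃) := by
  classical
  have hν (z : α) : z = z₁ ∨ z = z₂ ∨ z = z₃ ∨ (z ≠ z₁ ∧ z ≠ z₂ ∧ z ≠ z₃ ∧ ν z = 1) := by
    by_cases a : z = z₁
    · exact Or.inl a
    by_cases b : z = z₂
    · exact Or.inr (Or.inl b)
    by_cases c : z = z₃
    · exact Or.inr (Or.inr (Or.inl c))
    exact Or.inr (Or.inr (Or.inr ⟨a, b, c, hother z a b c⟩))
  have e3 : e z₃ = z₃ := by
    have h := hmin z₃
    rw [h₃] at h
    have hdvd : n ∣ ν (e z₃) := ⟨_, h⟩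
    rcases hν (e z₃) with h' | h' | h' | ⟨-, -, -, h'⟩
    · rw [h', h₁] at hdvd; have := Nat.le_of_dvd (by norm_num) hdvd; omega
    · rw [h', h₂] at hdvd; have := Nat.le_of_dvd (by norm_num) hdvd; omega
    · exact h'
    · rw [h'] at hdvd; have := Nat.le_of_dvd (by norm_num) hdvd; omega
  have d3 : Nat.gcd (d z₃) n = 1 := by
    have h := hmin z₃
    rw [e3, h₃] at h
    exact Nat.eq_of_mul_eq_mul_left (by omega : 0 < n) (by omega)
  have htwo (z : α) (hz : ν z = 2) : e z = z₁ ∨ e z = z₂ ∨ e z = z₃ := by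
    have h := hmin z
    rcases hν (e z) with h' | h' | h' | ⟨-, -, -, h'⟩
    · exact Or.inl h'
    · exact Or.inr (Or.inl h')
    · exact Or.inr (Or.inr h')
    · rw [hz, h'] at h; omega
  have hpar (w : α) (hw : ν w = 2) :
      (m : ZMod 2) = (if e z₁ = w then 1 else 0) + (if e z₂ = w then 1 else 0) := by
    obtain ⟨S, hS, hsum⟩ := hfib w
    have : ∀ z ∈ S, (d z : ZMod 2) = (if z = z₁ then 1 else 0) + (if z = z₂ then 1 else 0) := by
      intro z hz
      have h := hmin z
      rw [(hS z).1 hz, hw] at h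
      have hodd : Nat.gcd (d z) 2 = 1 → (d z : ZMod 2) = 1 := fun h =>
        (ZMod.natCast_eq_one_iff_odd).2 (Nat.coprime_two_right.1 h)
      rcases hν z with rfl | rfl | rfl | ⟨a, b, c, h'⟩
      · rw [h₁] at h; simp [h12, hodd (by omega)]
      · rw [h₂] at h; simp [h12.symm, hodd (by omega)]
      · rw [h₃] at h
        have := Nat.le_of_dvd (by norm_num) (Dvd.intro _ h.symm)
        omega
      · rw [h', one_mul] at h
        simp only [a, b, if_false, add_zero]
        exact (ZMod.natCast_eq_zero_iff _ _).2 (h ▸ Nat.gcd_dvd_left _ _)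
    rw [← hsum, Nat.cast_sum, Finset.sum_congr rfl this, Finset.sum_add_distrib,
      Finset.sum_ite_eq', Finset.sum_ite_eq']
    simp only [hS]
  have p1 := hpar z₁ h₁
  have p2 := hpar z₂ h₂
  have hone : (1 : ZMod 2) ≠ 0 := one_ne_zero
  have hnot : ¬ (e z₁ = z₃ ∧ e z₂ = z₃) := by
    rintro ⟨a, b⟩
    have hm0 : (m : ZMod 2) = 0 := by simpa [a, b, h13.symm, h23.symm] using p1
    have g1 := hmin z₁
    have g2 := hmin z₂
    rw [a, h₁, h₃] at g1
    rw [b, h₂, h₃] at g2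
    obtain ⟨k, hk⟩ : ∃ k, n = 2 * k := ⟨_, g1⟩
    have hk0 : 0 < k := by omega
    have hhalf (x : ℕ) (hx : n = 2 * Nat.gcd x n) : (x : ZMod 2) = k := by
      have hg : Nat.gcd x (2 * k) = k := by rw [← hk]; omega
      obtain ⟨o, ho⟩ : k ∣ x := by rw [← hg]; exact Nat.gcd_dvd_left _ _
      rw [ho, mul_comm 2 k, Nat.gcd_mul_left] at hg
      have ho1 : Nat.gcd o 2 = 1 := Nat.eq_of_mul_eq_mul_left hk0 (by omega)
      rw [ho, Nat.cast_mul, (ZMod.natCast_eq_one_iff_odd).2 (Nat.coprime_two_right.1 ho1), mul_one]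
    obtain ⟨S, hS, hsum⟩ := hfib z₃
    have : ∀ z ∈ S, (d z : ZMod 2) = (if z = z₁ then (k : ZMod 2) else 0) +
        (if z = z₂ then (k : ZMod 2) else 0) + (if z = z₃ then 1 else 0) := by
      intro z hz
      have h := hmin z
      rw [(hS z).1 hz, h₃] at h
      rcases hν z with rfl | rfl | rfl | ⟨a, b, c, h'⟩
      · simp [h12, h13, hhalf _ g1]
      · simp [h12.symm, h23, hhalf _ g2]
      · have : Nat.Coprime (d z) 2 := Nat.Coprime.coprime_dvd_right ⟨k, hk⟩ d3
        simp [h13.symm, h23.symm,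
          (ZMod.natCast_eq_one_iff_odd).2 (Nat.coprime_two_right.1 this)]
      · rw [h', one_mul] at h
        simp only [a, b, c, if_false, add_zero]
        refine (ZMod.natCast_eq_zero_iff _ _).2 (Dvd.dvd.trans ⟨k, hk⟩ ?_)
        exact h ▸ Nat.gcd_dvd_left _ _
    rw [← hsum, Nat.cast_sum, Finset.sum_congr rfl this, Finset.sum_add_distrib,
      Finset.sum_add_distrib, Finset.sum_ite_eq', Finset.sum_ite_eq', Finset.sum_ite_eq'] at hm0
    simp only [hS, a, b, e3, if_true, CharTwo.add_self_eq_zero, zero_add] at hm0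
    exact hone hm0
  have hmaps : (e z₁ = z₁ ∨ e z₁ = z₂) ∧ (e z₂ = z₁ ∨ e z₂ = z₂) := by
    rw [p1] at p2
    rcases htwo z₁ h₁ with a | a | a <;> rcases htwo z₂ h₂ with b | b | b <;>
      simp [a, b, h12, h12.symm, h13.symm, h23.symm] at p2 hnot ⊢
  by_cases hex : ∃ z, e z = z₃ ∧ z ≠ z₃
  · left
    obtain ⟨z, hz, hz3⟩ := hex
    obtain ⟨S, hS, hsum⟩ := hfib z₃
    have hz1 : z ≠ z₁ := by rintro rfl; rcases hmaps.1 with h | h <;> simp_all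
    have hz2 : z ≠ z₂ := by rintro rfl; rcases hmaps.2 with h | h <;> simp_all
    have h := hmin z
    rw [hz, h₃, hother z hz1 hz2 hz3, one_mul] at h
    have hle : n ≤ d z := Nat.le_of_dvd (hd z) (h ▸ Nat.gcd_dvd_left _ _)
    have hsub : ({z, z₃} : Finset α) ⊆ S := by
      intro y hy
      rw [hS]
      rcases Finset.mem_insert.1 hy with rfl | hy
      · exact hz
      · rw [Finset.mem_singleton.1 hy, e3]
    have := Finset.sum_le_sum_of_subset (f := d) hsub
    rw [Finset.sum_pair hz3, hsum] at this
    have := hd z₃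
    omega
  · right
    push Not at hex
    exact ⟨hmaps.1, hmaps.2, fun z => ⟨hex z, fun h => by rw [h, e3]⟩⟩

lemma exists_sq_of_even_rootMultiplicity {H : ℂ[X]}
    (h : ∀ z, Even (rootMultiplicity z H)) : ∃ Q, H = Q ^ 2 := by
  classical
  obtain ⟨a, ha⟩ := IsAlgClosed.exists_pow_nat_eq H.leadingCoeff (n := 2) (by norm_num)
  refine ⟨C a * ∏ z ∈ H.roots.toFinset, (X - C z) ^ (rootMultiplicity z H / 2), ?_⟩
  have hs := C_leadingCoeff_mul_prod_multiset_X_sub_C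
    (splits_iff_card_roots.1 (IsAlgClosed.splits H))
  rw [prod_multiset_root_eq_finset_root] at hs
  rw [mul_pow, ← C_pow, ha, ← Finset.prod_pow]
  conv_lhs => rw [← hs]
  congr 1
  refine Finset.prod_congr rfl fun z _ => ?_
  rw [← pow_mul, Nat.div_mul_cancel (h z).two_dvd]

/-- The first coordinate of the linear form `s X + t` vanishing at `w`. -/
def formCoeffOne (w : OnePoint ℂ) : ℂ := OnePoint.rec 0 (fun _ => 1) w

/-- The second coordinate of the linear form `s X + t` vanishing at `w`. -/
def formCoeffZero (w : OnePoint ℂ) : ℂ := OnePoint.rec 1 (fun w => -w) w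

@[simp] lemma formCoeffOne_infty : formCoeffOne ∞ = 0 := rfl

@[simp] lemma formCoeffOne_coe (w : ℂ) : formCoeffOne w = 1 := rfl

@[simp] lemma formCoeffZero_infty : formCoeffZero ∞ = 1 := rfl

@[simp] lemma formCoeffZero_coe (w : ℂ) : formCoeffZero w = -w := rfl

lemma fiberPoly_eq_coeff (P Q : ℂ[X]) (w : OnePoint ℂ) :
    fiberPoly P Q w = C (formCoeffOne w) * P + C (formCoeffZero w) * Q := by
  induction w using OnePoint.rec with
  | infty => simp
  | coe w => simp [sub_eq_add_neg]

lemma formCoeff_det_ne_zero {v w : OnePoint ℂ} (h : v ≠ w) :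
    formCoeffOne v * formCoeffZero w - formCoeffZero v * formCoeffOne w ≠ 0 := by
  induction v using OnePoint.rec with
  | infty =>
    induction w using OnePoint.rec with
    | infty => exact absurd rfl h
    | coe w => simp
  | coe v =>
    induction w using OnePoint.rec with
    | infty => simp
    | coe w =>
      have : w ≠ v := fun e => h (by rw [e])
      simpa [sub_eq_zero, neg_add_eq_zero] using this

lemma fiberPoly_X_one_ne_zero (w : OnePoint ℂ) : fiberPoly X 1 w ≠ 0 := by
  induction w using OnePoint.rec with
  | infty => simp
  | coe w => simpa using X_sub_C_ne_zero w

lemma rootMultiplicity_fiberPoly_X_one (w : OnePoint ℂ) (z : ℂ) :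
    rootMultiplicity z (fiberPoly X 1 w) = if (z : OnePoint ℂ) = w then 1 else 0 := by
  induction w using OnePoint.rec with
  | infty => simp [← C_1, -map_one]
  | coe w => simp [rootMultiplicity_X_sub_C]

lemma natDegree_fiberPoly_X_one (w : OnePoint ℂ) :
    (fiberPoly X 1 w).natDegree + (if ∞ = w then 1 else 0) = 1 := by
  induction w using OnePoint.rec with
  | infty => simp
  | coe w => simp

lemma fiberPoly_X_one_dvd_of_dvd_sq {w : OnePoint ℂ} {Q : ℂ[X]} (h : fiberPoly X 1 w ∣ Q ^ 2) :
    fiberPoly X 1 w ∣ Q := by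
  induction w using OnePoint.rec with
  | infty => simp
  | coe w =>
    rw [fiberPoly_coe, mul_one] at h ⊢
    exact (prime_X_sub_C w).dvd_of_dvd_pow h

lemma isCoprime_fiberPoly_X_one {v w : OnePoint ℂ} (h : v ≠ w) :
    IsCoprime (fiberPoly X 1 v) (fiberPoly X 1 w) := by
  induction v using OnePoint.rec with
  | infty => exact isCoprime_one_left
  | coe v =>
    induction w using OnePoint.rec with
    | infty => exact isCoprime_one_right
    | coe w =>
      simpa using isCoprime_X_sub_C_of_isUnit_sub
        (sub_ne_zero.2 (fun e => h (by rw [e]) : v ≠ w)).isUnit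

lemma exists_eq_linear_mul_sq {G₁ G₂ : ℂ[X]} {m : ℕ} {z₁ z₂ : OnePoint ℂ} (h12 : z₁ ≠ z₂)
    (h1 : G₁ ≠ 0) (h2 : G₂ ≠ 0) (d1 : G₁.natDegree ≤ m) (d2 : G₂.natDegree ≤ m)
    (heven : ∀ z, Even (formOrder m G₁ z + formOrder m G₂ z +
      (if z = z₁ then 1 else 0) + (if z = z₂ then 1 else 0))) :
    ∃ Q : ℂ[X], Q.natDegree + 1 ≤ m ∧ G₁ * G₂ = fiberPoly X 1 z₁ * fiberPoly X 1 z₂ * Q ^ 2 := by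
  have l1 := fiberPoly_X_one_ne_zero z₁
  have l2 := fiberPoly_X_one_ne_zero z₂
  have hG := mul_ne_zero h1 h2
  have hL := mul_ne_zero l1 l2
  obtain ⟨Q₀, hQ₀⟩ := exists_sq_of_even_rootMultiplicity
    (H := G₁ * G₂ * (fiberPoly X 1 z₁ * fiberPoly X 1 z₂)) (fun z => by
      have := heven z
      rw [rootMultiplicity_mul (mul_ne_zero hG hL), rootMultiplicity_mul hG,
        rootMultiplicity_mul hL, rootMultiplicity_fiberPoly_X_one, rootMultiplicity_fiberPoly_X_one]
      simpa [add_assoc] using this)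
  have hdvd : fiberPoly X 1 z₁ * fiberPoly X 1 z₂ ∣ Q₀ :=
    (isCoprime_fiberPoly_X_one h12).mul_dvd
      (fiberPoly_X_one_dvd_of_dvd_sq (hQ₀ ▸ ⟨G₁ * G₂ * fiberPoly X 1 z₂, by ring⟩))
      (fiberPoly_X_one_dvd_of_dvd_sq (hQ₀ ▸ ⟨G₁ * G₂ * fiberPoly X 1 z₁, by ring⟩))
  obtain ⟨Q, rfl⟩ := hdvd
  have hmain : G₁ * G₂ = fiberPoly X 1 z₁ * fiberPoly X 1 z₂ * Q ^ 2 := by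
    apply mul_right_cancel₀ hL
    rw [hQ₀]; ring
  refine ⟨Q, ?_, hmain⟩
  have hQ : Q ≠ 0 := by
    rintro rfl
    simp [h1, h2] at hmain
  have hdeg := congrArg natDegree hmain
  rw [natDegree_mul h1 h2, natDegree_mul hL (pow_ne_zero 2 hQ), natDegree_mul l1 l2,
    natDegree_pow] at hdeg
  have hinf := heven ∞
  rw [formOrder_infty, formOrder_infty] at hinf
  have e1 := natDegree_fiberPoly_X_one z₁
  have e2 := natDegree_fiberPoly_X_one z₂
  have hne : ¬ (∞ = z₁ ∧ ∞ = z₂) := fun h => h12 (h.1.symm.trans h.2)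
  rw [Nat.even_iff] at hinf
  split_ifs at hinf e1 e2 <;> first | omega | tauto

lemma eq_C_mul_pow_of_formOrder_eq {G : ℂ[X]} {m : ℕ} {w : OnePoint ℂ} (hG : G ≠ 0)
    (hd : G.natDegree ≤ m) (h : formOrder m G w = m) :
    ∃ κ : ℂ, κ ≠ 0 ∧ G = C κ * fiberPoly X 1 w ^ m := by
  induction w using OnePoint.rec with
  | infty =>
    rw [formOrder_infty] at h
    obtain ⟨κ, rfl⟩ := natDegree_eq_zero.1 (by omega : G.natDegree = 0)
    exact ⟨κ, by simpa using hG, by simp⟩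
  | coe w =>
    rw [formOrder_coe] at h
    obtain ⟨S, hS⟩ := pow_rootMultiplicity_dvd G w
    rw [h] at hS
    have hS0 : S ≠ 0 := by rintro rfl; simp at hS; exact hG hS
    have hdeg := natDegree_mul (pow_ne_zero m (X_sub_C_ne_zero w)) hS0
    rw [← hS, natDegree_pow, natDegree_X_sub_C] at hdeg
    obtain ⟨κ, rfl⟩ := natDegree_eq_zero.1 (by omega : S.natDegree = 0)
    exact ⟨κ, by simpa using hS0, by rw [fiberPoly_coe, mul_one, mul_comm]; exact hS⟩

/-- A binary form of degree `k` can be rewritten in terms of a linear change of variables. -/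
lemma exists_aeval_moebius {K : Type*} [Field K] [Algebra ℂ K] {a b c d : ℂ}
    (hΔ : a * d - b * c ≠ 0) (F : ℂ[X]) {k : ℕ} (hF : F.natDegree ≤ k) :
    ∃ P : ℂ[X], P.natDegree ≤ k ∧ ∀ x y : K,
      y * (algebraMap ℂ K c * x + algebraMap ℂ K d) = algebraMap ℂ K a * x + algebraMap ℂ K b →
      aeval x F = (algebraMap ℂ K c * x + algebraMap ℂ K d) ^ k * aeval y P := by
  refine ⟨∑ i ∈ Finset.range (k + 1), C (F.coeff i / (a * d - b * c) ^ k) *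
    ((C d * X - C b) ^ i * (C a - C c * X) ^ (k - i)), ?_, fun x y hxy => ?_⟩
  · refine natDegree_sum_le_of_forall_le _ _ fun i hi => ?_
    have hi : i ≤ k := Nat.lt_succ_iff.1 (Finset.mem_range.1 hi)
    refine (natDegree_C_mul_le _ _).trans (natDegree_mul_le.trans ?_)
    have n1 : (C d * X - C b).natDegree ≤ 1 := by compute_degree
    have n2 : (C a - C c * X).natDegree ≤ 1 := by compute_degree
    have m1 := natDegree_pow_le_of_le i n1
    have m2 := natDegree_pow_le_of_le (k - i) n2
    omega
  · rw [aeval_eq_sum_range' (Nat.lt_succ_of_le hF), map_sum, Finset.mul_sum]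
    refine Finset.sum_congr rfl fun i hi => ?_
    have hi : i ≤ k := Nat.lt_succ_iff.1 (Finset.mem_range.1 hi)
    have e1 : (algebraMap ℂ K d * y - algebraMap ℂ K b) *
        (algebraMap ℂ K c * x + algebraMap ℂ K d) = algebraMap ℂ K (a * d - b * c) * x := by
      simp only [map_sub, map_mul]
      linear_combination algebraMap ℂ K d * hxy
    have e2 : (algebraMap ℂ K a - algebraMap ℂ K c * y) *
        (algebraMap ℂ K c * x + algebraMap ℂ K d) = algebraMap ℂ K (a * d - b * c) := by
      simp only [map_sub, map_mul]
      linear_combination -algebraMap ℂ K c * hxy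
    have hΔK : algebraMap ℂ K (a * d - b * c) ≠ 0 := (_root_.map_ne_zero _).2 hΔ
    simp only [map_mul, map_pow, map_sub, aeval_C, aeval_X]
    rw [Algebra.smul_def, map_div₀, map_pow]
    obtain ⟨j, rfl⟩ := Nat.exists_eq_add_of_le hi
    rw [Nat.add_sub_cancel_left]
    trans algebraMap ℂ K (F.coeff i) / algebraMap ℂ K (a * d - b * c) ^ (i + j) *
      (((algebraMap ℂ K d * y - algebraMap ℂ K b) *
          (algebraMap ℂ K c * x + algebraMap ℂ K d)) ^ i *
        ((algebraMap ℂ K a - algebraMap ℂ K c * y) *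
          (algebraMap ℂ K c * x + algebraMap ℂ K d)) ^ j)
    · rw [e1, e2]
      field_simp
      ring
    · simp only [mul_pow, pow_add, map_mul, map_sub]
      ring

/-- The Möbius transformation `(a X + b) / (c X + d)`. -/
def moebius (a b c d : ℂ) : RatFunc ℂ :=
  algebraMap ℂ[X] (RatFunc ℂ) (C a * X + C b) / algebraMap ℂ[X] (RatFunc ℂ) (C c * X + C d)

lemma linear_ne_zero {a b c d : ℂ} (hΔ : a * d - b * c ≠ 0) : C c * X + C d ≠ (0 : ℂ[X]) := by
  intro h
  have h0 := congrArg (fun p => coeff p 0) h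
  have h1 := congrArg (fun p => coeff p 1) h
  simp at h0 h1
  simp [h0, h1] at hΔ

lemma moebius_mul {a b c d : ℂ} (hΔ : a * d - b * c ≠ 0) :
    moebius a b c d * (algebraMap ℂ _ c * RatFunc.X + algebraMap ℂ _ d) =
      algebraMap ℂ _ a * RatFunc.X + algebraMap ℂ _ b := by
  have h := RatFunc.algebraMap_ne_zero (linear_ne_zero hΔ)
  have := div_mul_cancel₀ (algebraMap ℂ[X] (RatFunc ℂ) (C a * X + C b)) h
  simpa [moebius, RatFunc.algebraMap_C, RatFunc.algebraMap_X, RatFunc.algebraMap_eq_C] using this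

lemma transcendental_moebius {a b c d : ℂ} (hΔ : a * d - b * c ≠ 0) :
    Transcendental ℂ (moebius a b c d) := by
  apply RatFunc.transcendental_of_ne_C
  rintro ⟨k, hk⟩
  rw [moebius, div_eq_iff (RatFunc.algebraMap_ne_zero (linear_ne_zero hΔ)), ← RatFunc.algebraMap_C,
    ← map_mul] at hk
  have hk := RatFunc.algebraMap_injective ℂ hk
  have h0 := congrArg (fun p => coeff p 0) hk
  have h1 := congrArg (fun p => coeff p 1) hk
  simp at h0 h1
  apply hΔ
  rw [h0, h1]; ring

lemma rcomp_div {g : RatFunc ℂ} (hg : Transcendental ℂ g) (P : ℂ[X]) {Q : ℂ[X]} (hQ : Q ≠ 0) :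
    rcomp (algebraMap ℂ[X] (RatFunc ℂ) P / algebraMap ℂ[X] (RatFunc ℂ) Q) g =
      aeval g P / aeval g Q := by
  have h0 {F : ℂ[X]} (hF : F ≠ 0) : aeval g F ≠ 0 := fun h => hg ⟨F, hF, h⟩
  have h := (RatFunc.num_mul_eq_mul_denom_iff (p := P) hQ).2 rfl
  rw [rcomp, div_eq_div_iff (h0 (RatFunc.denom_ne_zero _)) (h0 hQ), ← map_mul, ← map_mul, h]

lemma rcomp_moebius {a b c d : ℂ} (hΔ : a * d - b * c ≠ 0) {g : RatFunc ℂ}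
    (hg : Transcendental ℂ g) : rcomp (moebius a b c d) g =
      (algebraMap ℂ _ a * g + algebraMap ℂ _ b) / (algebraMap ℂ _ c * g + algebraMap ℂ _ d) := by
  rw [moebius, rcomp_div hg _ (linear_ne_zero hΔ)]
  simp

lemma linear_eval_ne_zero {a b c d : ℂ} (hΔ : a * d - b * c ≠ 0) {g : RatFunc ℂ}
    (hg : Transcendental ℂ g) : algebraMap ℂ _ c * g + algebraMap ℂ _ d ≠ 0 := fun h =>
  hg ⟨C c * X + C d, linear_ne_zero hΔ, by simpa using h⟩

lemma rcomp_moebius_moebius_inv {a b c d : ℂ} (hΔ : a * d - b * c ≠ 0) :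
    rcomp (moebius d (-b) (-c) a) (moebius a b c d) = RatFunc.X := by
  have hΔ' : d * a - -b * -c ≠ 0 := by convert hΔ using 1; ring
  have ht := transcendental_moebius hΔ
  rw [rcomp_moebius hΔ' ht, div_eq_iff (linear_eval_ne_zero hΔ' ht)]
  simp only [map_neg]
  linear_combination moebius_mul hΔ

lemma algebraMap_linear (a b : ℂ) : algebraMap ℂ[X] (RatFunc ℂ) (C a * X + C b) =
    algebraMap ℂ _ a * RatFunc.X + algebraMap ℂ _ b := by
  simp [RatFunc.algebraMap_C, RatFunc.algebraMap_X, RatFunc.algebraMap_eq_C]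

lemma natDegree_eq_of_moebius_form {a b c d : ℂ} (hΔ : a * d - b * c ≠ 0) {p q P : ℂ[X]}
    (hpq : IsCoprime p q) {m : ℕ} (hm : 1 ≤ m) (hdeg : max p.natDegree q.natDegree = m)
    (hP : P.natDegree ≤ m) {κ : ℂ}
    (hF : algebraMap ℂ[X] (RatFunc ℂ) (C a * p + C b * q) =
      algebraMap ℂ[X] (RatFunc ℂ) (C c * X + C d) ^ m * aeval (moebius a b c d) P)
    (hE : C c * p + C d * q = C κ * (C c * X + C d) ^ m) : P.natDegree = m := by
  by_contra hne
  obtain ⟨k, rfl⟩ : ∃ k, m = k + 1 := ⟨m - 1, by omega⟩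
  have hΔ' : d * a - -b * -c ≠ 0 := by convert hΔ using 1; ring
  have hmul := moebius_mul hΔ
  obtain ⟨F, hFdeg, hF'⟩ := exists_aeval_moebius (K := RatFunc ℂ) hΔ' P
    (by omega : P.natDegree ≤ k)
  have hPF := hF' (moebius a b c d) RatFunc.X (by
    simp only [map_neg]; linear_combination -hmul)
  rw [RatFunc.aeval_X_left_eq_algebraMap] at hPF
  have hcancel : (algebraMap ℂ (RatFunc ℂ) (-c) * moebius a b c d + algebraMap ℂ _ a) *
      algebraMap ℂ[X] (RatFunc ℂ) (C c * X + C d) =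
      algebraMap ℂ[X] (RatFunc ℂ) (C (a * d - b * c)) := by
    rw [algebraMap_linear, RatFunc.algebraMap_C, ← RatFunc.algebraMap_eq_C]
    simp only [map_neg, map_sub, map_mul]
    linear_combination -algebraMap ℂ _ c * hmul
  have hpoly : C a * p + C b * q = (C c * X + C d) * (C (a * d - b * c) ^ k * F) := by
    apply RatFunc.algebraMap_injective ℂ
    rw [hF, hPF, map_mul _ (C c * X + C d), map_mul, map_pow, ← hcancel, mul_pow]
    ring
  have hdet : C (a * d - b * c) * C (a * d - b * c)⁻¹ = (1 : ℂ[X]) := by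
    rw [← C_mul, mul_inv_cancel₀ hΔ, C_1]
  have hp : p = C (a * d - b * c)⁻¹ *
      (C d * (C a * p + C b * q) - C b * (C c * p + C d * q)) := by
    simp only [C_sub, C_mul] at hdet
    linear_combination -p * hdet
  have hq : q = C (a * d - b * c)⁻¹ *
      (C a * (C c * p + C d * q) - C c * (C a * p + C b * q)) := by
    simp only [C_sub, C_mul] at hdet
    linear_combination -q * hdet
  have hdvd1 : C c * X + C d ∣ C a * p + C b * q := ⟨_, hpoly⟩
  have hdvd2 : C c * X + C d ∣ C c * p + C d * q :=
    hE ▸ (dvd_pow_self _ k.succ_ne_zero).mul_left _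
  have hunit : IsUnit (C c * X + C d) := hpq.isUnit_of_dvd'
    (hp ▸ ((hdvd1.mul_left _).sub (hdvd2.mul_left _)).mul_left _)
    (hq ▸ ((hdvd2.mul_left _).sub (hdvd1.mul_left _)).mul_left _)
  obtain ⟨e, -, he⟩ := Polynomial.isUnit_iff.1 hunit
  have n1 : (C a * p + C b * q).natDegree ≤ k := by
    rw [hpoly, ← he, ← C_pow]
    exact (natDegree_C_mul_le _ _).trans ((natDegree_C_mul_le _ _).trans hFdeg)
  have n2 : (C c * p + C d * q).natDegree ≤ k := by
    rw [hE, ← he, ← C_pow, ← C_mul, natDegree_C]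
    exact Nat.zero_le k
  have hple : p.natDegree ≤ k := by
    rw [hp]
    refine (natDegree_C_mul_le _ _).trans ?_
    simpa using natDegree_sub_le_of_le ((natDegree_C_mul_le d _).trans n1)
      ((natDegree_C_mul_le b _).trans n2)
  have hqle : q.natDegree ≤ k := by
    rw [hq]
    refine (natDegree_C_mul_le _ _).trans ?_
    simpa using natDegree_sub_le_of_le ((natDegree_C_mul_le a _).trans n2)
      ((natDegree_C_mul_le c _).trans n1)
  omega

lemma conjugate_algebraMap {a b c d : ℂ} (hΔ : a * d - b * c ≠ 0) {A : RatFunc ℂ} {P : ℂ[X]}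
    (hP : P.natDegree ≠ 0)
    (hA : algebraMap ℂ _ a * A + algebraMap ℂ _ b =
      aeval (moebius a b c d) P * (algebraMap ℂ _ c * A + algebraMap ℂ _ d)) :
    Conjugate A (algebraMap ℂ[X] (RatFunc ℂ) P) := by
  have hΔ' : d * a - -b * -c ≠ 0 := by convert hΔ using 1; ring
  have ht := transcendental_moebius hΔ
  have htP : Transcendental ℂ (algebraMap ℂ[X] (RatFunc ℂ) P) := by
    apply RatFunc.transcendental_of_ne_C
    rintro ⟨k, hk⟩
    rw [← RatFunc.algebraMap_C] at hk
    rw [RatFunc.algebraMap_injective ℂ hk, natDegree_C] at hP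
    exact hP rfl
  have hinv : rcomp (moebius a b c d) (moebius d (-b) (-c) a) = RatFunc.X := by
    simpa using rcomp_moebius_moebius_inv hΔ'
  refine ⟨moebius d (-b) (-c) a, moebius a b c d, rcomp_moebius_moebius_inv hΔ, hinv, ?_⟩
  have hpoly (u v : ℂ) : algebraMap ℂ _ u * algebraMap ℂ[X] (RatFunc ℂ) P + algebraMap ℂ _ v =
      algebraMap ℂ[X] (RatFunc ℂ) (C u * P + C v) := by
    simp [RatFunc.algebraMap_C, RatFunc.algebraMap_eq_C]
  have hden := linear_eval_ne_zero hΔ' htP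
  rw [rcomp_moebius hΔ' htP, hpoly, hpoly, rcomp_div ht]
  · have hden' : aeval (moebius a b c d) (C (-c) * P + C a) ≠ 0 := fun h => by
      refine ht ⟨_, ?_, h⟩
      rw [hpoly] at hden
      exact fun h0 => hden (by rw [h0, map_zero])
    rw [eq_div_iff hden']
    simp only [map_add, map_mul, aeval_C, map_neg]
    linear_combination hA
  · rw [hpoly] at hden
    exact fun h0 => hden (by rw [h0, map_zero])

lemma conjugate_chebyshev_of_formOrder {A : RatFunc ℂ} (hA : 1 ≤ rdeg A) {z₁ z₂ z₃ : OnePoint ℂ}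
    (h12 : z₁ ≠ z₂) (h13 : z₁ ≠ z₃) (h23 : z₂ ≠ z₃)
    (h3 : formOrder (rdeg A) (fiberPoly A.num A.denom z₃) z₃ = rdeg A)
    (heven : ∀ z, Even (formOrder (rdeg A) (fiberPoly A.num A.denom z₁) z +
      formOrder (rdeg A) (fiberPoly A.num A.denom z₂) z +
      (if z = z₁ then 1 else 0) + (if z = z₂ then 1 else 0))) :
    Conjugate A (chebyRF (rdeg A)) ∨ Conjugate A (-(chebyRF (rdeg A))) := by
  have d12 := formCoeff_det_ne_zero h12
  have d13 := formCoeff_det_ne_zero h13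
  have d23 := formCoeff_det_ne_zero h23
  have hcoef := fiberPoly_eq_coeff
  obtain ⟨Q, hQdeg, hQ⟩ := exists_eq_linear_mul_sq h12
    (fiberPoly_num_denom_ne_zero hA z₁) (fiberPoly_num_denom_ne_zero hA z₂)
    (natDegree_fiberPoly_num_denom_le A z₁) (natDegree_fiberPoly_num_denom_le A z₂) heven
  obtain ⟨κ, hκ, hG3⟩ := eq_C_mul_pow_of_formOrder_eq (fiberPoly_num_denom_ne_zero hA z₃)
    (natDegree_fiberPoly_num_denom_le A z₃) h3
  obtain ⟨α, β, γ, hα, hβ, hγ, hs, ht⟩ : ∃ α β γ : ℂ, α ≠ 0 ∧ β ≠ 0 ∧ γ ≠ 0 ∧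
      α * formCoeffOne z₁ + 2 * γ * formCoeffOne z₃ = β * formCoeffOne z₂ ∧
      α * formCoeffZero z₁ + 2 * γ * formCoeffZero z₃ = β * formCoeffZero z₂ := by
    refine ⟨_, _, _, d23, d13, div_ne_zero d12 (two_ne_zero (α := ℂ)), ?_, ?_⟩ <;> ring
  set m := rdeg A with hm
  set p := A.num
  set q := A.denom
  obtain ⟨a, b, c, d, ha, hb, hc, hd⟩ : ∃ a b c d : ℂ,
      a = α * formCoeffOne z₁ + γ * formCoeffOne z₃ ∧
      b = α * formCoeffZero z₁ + γ * formCoeffZero z₃ ∧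
      c = γ * formCoeffOne z₃ ∧ d = γ * formCoeffZero z₃ := ⟨_, _, _, _, rfl, rfl, rfl, rfl⟩
  have hΔ : a * d - b * c ≠ 0 := by
    convert mul_ne_zero (mul_ne_zero hα hγ) d13 using 1
    rw [ha, hb, hc, hd]; ring
  have form3 (P Q : ℂ[X]) : C c * P + C d * Q = C γ * fiberPoly P Q z₃ := by
    rw [hcoef, hc, hd]; simp only [C_mul]; ring
  have form1 (P Q : ℂ[X]) : (C a * P + C b * Q) - (C c * P + C d * Q) =
      C α * fiberPoly P Q z₁ := by
    rw [hcoef, ha, hb, hc, hd]; simp only [C_mul, C_add]; ring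
  have form2 (P Q : ℂ[X]) : (C a * P + C b * Q) + (C c * P + C d * Q) =
      C β * fiberPoly P Q z₂ := by
    have e1 := congrArg (C : ℂ → ℂ[X]) hs
    have e2 := congrArg (C : ℂ → ℂ[X]) ht
    rw [hcoef, ha, hb, hc, hd]
    simp only [C_mul, C_add, C_ofNat] at e1 e2 ⊢
    linear_combination P * e1 + Q * e2
  have hlin (u v : ℂ) : C u * X + C v * 1 = (C u * X + C v : ℂ[X]) := by rw [mul_one]
  obtain ⟨κ', hκ', hE⟩ : ∃ κ' : ℂ, κ' ≠ 0 ∧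
      C c * p + C d * q = C κ' * (C c * X + C d) ^ m := by
    refine ⟨γ * κ / γ ^ m, by positivity, ?_⟩
    rw [form3, hG3, ← hlin, form3, mul_pow, ← C_pow, ← mul_assoc, ← mul_assoc, ← C_mul, ← C_mul,
      div_mul_cancel₀ _ (pow_ne_zero m hγ)]
  have hsq : (C a * p + C b * q) ^ 2 - (C c * p + C d * q) ^ 2 =
      ((C a * X + C b) ^ 2 - (C c * X + C d) ^ 2) * Q ^ 2 := by
    have e1 := form1 p q
    have e2 := form2 p q
    have f1 := form1 X 1
    have f2 := form2 X 1
    rw [hlin, hlin] at f1 f2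
    rw [sq_sub_sq, sq_sub_sq, e1, e2, f1, f2]
    linear_combination C α * C β * hQ
  have hFdeg : (C a * p + C b * q).natDegree ≤ m := by
    refine natDegree_add_le_of_degree_le ?_ ?_
    · exact (natDegree_C_mul_le _ _).trans (le_max_left _ _)
    · exact (natDegree_C_mul_le _ _).trans (le_max_right _ _)
  have hmul := moebius_mul hΔ
  obtain ⟨P₀, hP₀deg, hP₀⟩ := exists_aeval_moebius (K := RatFunc ℂ) hΔ _ hFdeg
  obtain ⟨R₀, -, hR₀⟩ := exists_aeval_moebius (K := RatFunc ℂ) hΔ Q (by omega : Q.natDegree ≤ m - 1)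
  have hF := hP₀ _ _ hmul
  have hQF := hR₀ _ _ hmul
  rw [RatFunc.aeval_X_left_eq_algebraMap, ← algebraMap_linear] at hF hQF
  rw [← algebraMap_linear, ← algebraMap_linear] at hmul
  have hD0 := RatFunc.algebraMap_ne_zero (K := ℂ) (linear_ne_zero hΔ)
  have hP₀m := natDegree_eq_of_moebius_form hΔ A.isCoprime_num_denom hA rfl hP₀deg hF hE
  have hpell₀ : P₀ ^ 2 - C κ' ^ 2 = (X ^ 2 - 1) * R₀ ^ 2 := by
    apply transcendental_iff_injective.1 (transcendental_moebius hΔ)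
    have h := congrArg (algebraMap ℂ[X] (RatFunc ℂ)) hsq
    rw [hE] at h
    simp only [map_sub, map_mul _ _ (Q ^ 2), map_pow _ _ 2] at h
    rw [hF, hQF, ← hmul, map_mul, map_pow] at h
    simp only [map_sub, map_mul, map_pow, aeval_C, aeval_X, map_one]
    rw [RatFunc.algebraMap_C, ← RatFunc.algebraMap_eq_C] at h
    obtain ⟨k, hk⟩ : ∃ k, m = k + 1 := ⟨m - 1, by omega⟩
    rw [hk, Nat.add_sub_cancel] at h
    apply mul_left_cancel₀ (pow_ne_zero (2 * (k + 1)) hD0)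
    linear_combination h
  have hκC : (C κ' * C κ'⁻¹ : ℂ[X]) = 1 := by rw [← C_mul, mul_inv_cancel₀ hκ', C_1]
  have hpell : (C κ'⁻¹ * P₀) ^ 2 - 1 = (X ^ 2 - 1) * (C κ'⁻¹ * R₀) ^ 2 := by
    linear_combination C κ'⁻¹ ^ 2 * hpell₀ + (C κ' * C κ'⁻¹ + 1) * hκC
  have hdeg : (C κ'⁻¹ * P₀).natDegree = m := by
    rw [natDegree_C_mul (inv_ne_zero hκ'), hP₀m]
  have hconj : Conjugate A (algebraMap ℂ[X] (RatFunc ℂ) (C κ'⁻¹ * P₀)) := by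
    refine conjugate_algebraMap hΔ (by omega) ?_
    have hq0 := RatFunc.algebraMap_ne_zero (K := ℂ) A.denom_ne_zero
    have hpq : algebraMap ℂ[X] (RatFunc ℂ) p = A * algebraMap ℂ[X] (RatFunc ℂ) q := by
      rw [← div_eq_iff hq0]; exact A.num_div_denom
    have hE' := congrArg (algebraMap ℂ[X] (RatFunc ℂ)) hE
    have hC (u : ℂ) : algebraMap ℂ[X] (RatFunc ℂ) (C u) = algebraMap ℂ _ u := by
      rw [RatFunc.algebraMap_C, RatFunc.algebraMap_eq_C]
    simp only [map_add _ (C _ * p), map_mul _ _ p, map_mul _ _ q, hC, hpq] at hF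
    simp only [map_add _ (C _ * p), map_mul _ _ p, map_mul _ _ q, hC, hpq] at hE'
    rw [map_mul, map_pow, hC] at hE'
    have hk : algebraMap ℂ (RatFunc ℂ) κ' * algebraMap ℂ (RatFunc ℂ) κ'⁻¹ = 1 := by
      rw [← map_mul, mul_inv_cancel₀ hκ', map_one]
    rw [map_mul, aeval_C]
    apply mul_right_cancel₀ hq0
    linear_combination hF - algebraMap ℂ (RatFunc ℂ) κ'⁻¹ * aeval (moebius a b c d) P₀ * hE' -
      algebraMap ℂ[X] (RatFunc ℂ) (C c * X + C d) ^ m * aeval (moebius a b c d) P₀ * hk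
  rcases (pell_eq_chebyshev m _ _ hdeg hpell).1 with h | h
  · left
    rwa [h] at hconj
  · right
    rwa [h, map_neg] at hconj

/-- **Corollary (signature `{2,2,n}`).** If `A` has degree `m ≥ 2` and `A : O → O` is a
minimal holomorphic self-map of an orbifold with exactly three singular points, of
ramifications `2, 2, n` with `n > 2`, then `m ≥ n + 1` unless `A` is conjugate to `T_m`
or `-T_m`. -/
theorem signature_22n_degree_bound (A : RatFunc ℂ) (m : ℕ) (hm : 2 ≤ m)
    (hdeg : rdeg A = m) (n : ℕ) (hn : 2 < n) (O : Orbifold)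
    (z₁ z₂ z₃ : OnePoint ℂ) (h12 : z₁ ≠ z₂) (h13 : z₁ ≠ z₃) (h23 : z₂ ≠ z₃)
    (h₁ : O.nu z₁ = 2) (h₂ : O.nu z₂ = 2) (h₃ : O.nu z₃ = n)
    (hother : ∀ z, z ≠ z₁ → z ≠ z₂ → z ≠ z₃ → O.nu z = 1)
    (hmin : IsMinHolo A O O) :
    n + 1 ≤ m ∨ Conjugate A (chebyRF m) ∨ Conjugate A (-(chebyRF m)) := by
  subst hdeg
  have hA : 1 ≤ rdeg A := by omega
  have hd (z : OnePoint ℂ) : 1 ≤ locDeg A z := by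
    rw [locDeg_eq_formOrder hA]
    exact (evalOP_eq_iff hA z _).1 rfl
  have horder (w z : OnePoint ℂ) : formOrder (rdeg A) (fiberPoly A.num A.denom w) z =
      if evalOP A z = w then locDeg A z else 0 := by
    split_ifs with h
    · rw [locDeg_eq_formOrder hA, h]
    · rw [evalOP_eq_iff hA] at h
      omega
  rcases degree_bound_or_invariant hn h12 h13 h23 h₁ h₂ h₃ hother hmin hd (exists_fiber_sum hA)
    with h | ⟨he1, he2, he3⟩
  · exact Or.inl h
  refine Or.inr (conjugate_chebyshev_of_formOrder hA h12 h13 h23 ?_ fun z => ?_)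
  · obtain ⟨S, hS, hsum⟩ := exists_fiber_sum hA z₃
    have hSz : S = {z₃} := by
      ext z
      rw [hS, he3, Finset.mem_singleton]
    rw [hSz, Finset.sum_singleton] at hsum
    rw [horder, if_pos ((he3 z₃).2 rfl), hsum]
  · have hz := hmin z
    have hpar : (evalOP A z = z₁ ∨ evalOP A z = z₂) → Even (locDeg A z +
        (if z = z₁ then 1 else 0) + (if z = z₂ then 1 else 0)) := by
      intro h
      have h2 : O.nu (evalOP A z) = 2 := by rcases h with h | h <;> rw [h] <;> assumption
      have hz3 : z ≠ z₃ := by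
        rintro rfl
        rw [h2, h₃] at hz
        have := Nat.le_of_dvd (by norm_num) (Dvd.intro _ hz.symm)
        omega
      rw [h2] at hz
      by_cases hz1 : z = z₁ ∨ z = z₂
      · have hν : O.nu z = 2 := by rcases hz1 with h | h <;> rw [h] <;> assumption
        have hodd : Odd (locDeg A z) := Nat.coprime_two_right.1 (by
          rw [Nat.Coprime]; rw [hν] at hz; omega)
        rcases hz1 with rfl | rfl
        · simpa [h12] using hodd.add_one
        · simpa [h12.symm] using hodd.add_one
      · push Not at hz1
        rw [hother z hz1.1 hz1.2 hz3, one_mul] at hz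
        simpa [hz1.1, hz1.2] using even_iff_two_dvd.2 (hz ▸ Nat.gcd_dvd_left (locDeg A z) 2)
    rw [horder, horder]
    by_cases h1 : evalOP A z = z₁
    · simpa [h1, h12] using hpar (Or.inl h1)
    by_cases h2 : evalOP A z = z₂
    · simpa [h2, h12.symm] using hpar (Or.inr h2)
    have hz1 : z ≠ z₁ := by rintro rfl; tauto
    have hz2 : z ≠ z₂ := by rintro rfl; tauto
    simp [h1, h2, hz1, hz2]

end GenLattes
end
end

section
/- Let n ≥ 2 and let ζ be a primitive n-th root of unity in ℂ. For nonconstant rational functions A, F ∈ ℂ(X), the following two conditions are equivalent: (i) A(X^n) = F(X)^n and there exists an integer r with gcd(r, n) = 1 such that F(ζX) = ζ^r · F(X); (ii) there exist R ∈ ℂ(X) and an integer r with 0 ≤ r ≤ n − 1, gcd(r, n) = 1, such that A = X^r · R(X)^n and F = X^r · R(X^n). -/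
open Polynomial OnePoint
open scoped Classical

noncomputable section

namespace GenLattes

/-- Substitution of a transcendental `g`, as an algebra endomorphism of `ℂ(X)`. -/
def substHom (g : RatFunc ℂ) (hg : Function.Injective (Polynomial.aeval (R := ℂ) g)) :
    RatFunc ℂ →ₐ[ℂ] RatFunc ℂ :=
  RatFunc.liftAlgHom (Polynomial.aeval g)
    (nonZeroDivisors_le_comap_nonZeroDivisors_of_injective _ hg)

theorem substHom_apply (g : RatFunc ℂ) (hg) (f : RatFunc ℂ) : substHom g hg f = rcomp f g :=
  RatFunc.liftAlgHom_apply _ _ f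

theorem substHom_algebraMap (g : RatFunc ℂ) (hg) (p : ℂ[X]) :
    substHom g hg (algebraMap ℂ[X] (RatFunc ℂ) p) = Polynomial.aeval g p := by
  simpa [substHom] using RatFunc.liftAlgHom_apply_div' (Polynomial.aeval g)
    (nonZeroDivisors_le_comap_nonZeroDivisors_of_injective _ hg) p 1

theorem substHom_X (g : RatFunc ℂ) (hg) : substHom g hg RatFunc.X = g := by
  rw [← RatFunc.algebraMap_X, substHom_algebraMap, aeval_X]

theorem aeval_algebraMap_eq_comp (p q : ℂ[X]) :
    Polynomial.aeval (algebraMap ℂ[X] (RatFunc ℂ) q) p = algebraMap ℂ[X] (RatFunc ℂ) (p.comp q) := by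
  rw [Polynomial.aeval_algebraMap_apply, Polynomial.comp_eq_aeval]

theorem aeval_injective_of_natDegree_pos {q : ℂ[X]} (hq : 0 < q.natDegree) :
    Function.Injective (Polynomial.aeval (R := ℂ) (algebraMap ℂ[X] (RatFunc ℂ) q)) := by
  rw [injective_iff_map_eq_zero]
  intro p hp
  rw [aeval_algebraMap_eq_comp, map_eq_zero_iff _ (RatFunc.algebraMap_injective ℂ),
    Polynomial.comp_eq_zero_iff] at hp
  rcases hp with hp | ⟨-, hp⟩
  · exact hp
  · rw [hp, natDegree_C] at hq
    exact absurd hq (lt_irrefl _)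

/-- A polynomial invariant under `X ↦ ζX` is a polynomial in `X ^ n`. -/
theorem exists_expand_of_comp_eq {n : ℕ} (hn : n ≠ 0) {ζ : ℂ} (hζ : IsPrimitiveRoot ζ n)
    {p : ℂ[X]} (hp : p.comp (C ζ * X) = p) : ∃ q : ℂ[X], p = q.comp (X ^ n) := by
  refine ⟨contract n p, ?_⟩
  rw [← expand_eq_comp_X_pow]
  ext k
  rw [coeff_expand (Nat.pos_of_ne_zero hn)]
  split_ifs with hk
  · rw [coeff_contract hn, Nat.div_mul_cancel hk]
  · have h := congrArg (fun f => coeff f k) hp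
    simp only [comp_C_mul_X_coeff] at h
    by_contra h0
    exact hk (hζ.dvd_of_pow_eq_one k (mul_left_cancel₀ h0 (h.trans (mul_one _).symm)))

/-- Every nonzero polynomial divides a nonzero polynomial invariant under `X ↦ ζX`. -/
theorem exists_dvd_comp_eq {n : ℕ} (hn : n ≠ 0) {ζ : ℂ} (hζ : ζ ^ n = 1)
    {q : ℂ[X]} (hq : q ≠ 0) : ∃ N : ℂ[X], N ≠ 0 ∧ q ∣ N ∧ N.comp (C ζ * X) = N := by
  have hζ0 : ζ ≠ 0 := by
    rintro rfl
    simp [hn] at hζ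
  set s : ℕ → ℂ[X] := fun i => q.comp (C (ζ ^ i) * X) with hs
  have h_zero : s 0 = q := by simp [hs]
  have h_last : s n = q := by simp only [hs, hζ, C_1, one_mul, comp_X]
  refine ⟨∏ i ∈ Finset.range n, s i, ?_, ?_, ?_⟩
  · refine Finset.prod_ne_zero_iff.2 fun i _ h => hq ?_
    ext k
    have := congrArg (fun f => coeff f k) h
    simpa only [hs, comp_C_mul_X_coeff, coeff_zero, mul_eq_zero, pow_ne_zero, hζ0, ne_eq,
      not_false_eq_true, or_false] using this
  · rw [← h_zero]
    exact Finset.dvd_prod_of_mem s (Finset.mem_range.2 (Nat.pos_of_ne_zero hn))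
  · have h_succ : ∀ i, (s i).comp (C ζ * X) = s (i + 1) := by
      intro i
      simp only [hs, comp_assoc]
      congr 1
      simp [pow_succ, mul_assoc]
    rw [prod_comp, Finset.prod_congr rfl fun i _ => h_succ i]
    apply mul_right_cancel₀ hq
    conv_lhs => rw [← h_zero]
    rw [← Finset.prod_range_succ', Finset.prod_range_succ, h_last]

theorem aeval_X_pow_injective {n : ℕ} (hn : n ≠ 0) :
    Function.Injective (Polynomial.aeval (R := ℂ) ((RatFunc.X : RatFunc ℂ) ^ n)) := by
  rw [← RatFunc.algebraMap_X, ← map_pow]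
  exact aeval_injective_of_natDegree_pos (by simpa using Nat.pos_of_ne_zero hn)

theorem aeval_C_mul_X_injective {ζ : ℂ} (hζ : ζ ≠ 0) :
    Function.Injective (Polynomial.aeval (R := ℂ) (RatFunc.C ζ * RatFunc.X : RatFunc ℂ)) := by
  rw [← RatFunc.algebraMap_X, ← RatFunc.algebraMap_C, ← map_mul]
  exact aeval_injective_of_natDegree_pos (by rw [natDegree_C_mul_X _ hζ]; exact one_pos)

/-- A rational function invariant under `X ↦ ζX` is a rational function of `X ^ n`. -/
theorem exists_rcomp_X_pow_of_rcomp_eq {n : ℕ} (hn : n ≠ 0) {ζ : ℂ} (hζ : IsPrimitiveRoot ζ n)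
    {H : RatFunc ℂ} (hH : rcomp H (RatFunc.C ζ * RatFunc.X) = H) :
    ∃ R : RatFunc ℂ, H = rcomp R (RatFunc.X ^ n) := by
  have hζ0 := aeval_C_mul_X_injective (hζ.ne_zero hn)
  obtain ⟨N, hN0, ⟨M, hM⟩, hN⟩ := exists_dvd_comp_eq hn hζ.pow_eq_one H.denom_ne_zero
  have h_alg : ∀ p : ℂ[X], substHom _ hζ0 (algebraMap ℂ[X] (RatFunc ℂ) p) =
      algebraMap ℂ[X] (RatFunc ℂ) (p.comp (C ζ * X)) := by
    intro p
    rw [substHom_algebraMap, ← aeval_algebraMap_eq_comp, map_mul, RatFunc.algebraMap_X,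
      RatFunc.algebraMap_C]
  have hN0' : algebraMap ℂ[X] (RatFunc ℂ) N ≠ 0 := RatFunc.algebraMap_ne_zero hN0
  have hd0 : algebraMap ℂ[X] (RatFunc ℂ) H.denom ≠ 0 := RatFunc.algebraMap_ne_zero H.denom_ne_zero
  have h_num : algebraMap ℂ[X] (RatFunc ℂ) (H.num * M) = H * algebraMap ℂ[X] (RatFunc ℂ) N := by
    rw [hM, map_mul, map_mul, ← mul_assoc, ← (div_eq_iff hd0).1 (RatFunc.num_div_denom H)]
  have h_inv : (H.num * M).comp (C ζ * X) = H.num * M := by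
    apply RatFunc.algebraMap_injective ℂ
    rw [← h_alg, h_num, map_mul, h_alg, hN, substHom_apply, hH]
  obtain ⟨a, ha⟩ := exists_expand_of_comp_eq hn hζ h_inv
  obtain ⟨b, hb⟩ := exists_expand_of_comp_eq hn hζ hN
  refine ⟨algebraMap ℂ[X] (RatFunc ℂ) a / algebraMap ℂ[X] (RatFunc ℂ) b, ?_⟩
  rw [← substHom_apply _ (aeval_X_pow_injective hn), map_div₀, substHom_algebraMap,
    substHom_algebraMap, ← RatFunc.algebraMap_X, ← map_pow, aeval_algebraMap_eq_comp,
    aeval_algebraMap_eq_comp, ← ha, ← hb, h_num, mul_div_cancel_right₀ _ hN0']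

/-- **Theorem (good solutions of `A ∘ z^n = z^n ∘ F`).** For nonconstant rational
functions `A, F`, the conditions `A(X^n) = F(X)^n` and `F(ζX) = ζ^r F(X)` for some
integer `r` coprime with `n` hold if and only if `A = X^r R(X)^n` and `F = X^r R(X^n)`
for some rational function `R` and some `0 ≤ r ≤ n - 1` coprime with `n`. -/
theorem good_solutions_power (n : ℕ) (hn : 2 ≤ n) (ζ : ℂ) (hζ : IsPrimitiveRoot ζ n)
    (A F : RatFunc ℂ) (hA : 1 ≤ rdeg A) (hF : 1 ≤ rdeg F) :
    (rcomp A (RatFunc.X ^ n) = F ^ n ∧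
      ∃ r : ℤ, Int.gcd r n = 1 ∧
        rcomp F (RatFunc.C ζ * RatFunc.X) = RatFunc.C (ζ ^ r) * F) ↔
    (∃ (R : RatFunc ℂ) (r : ℕ), r ≤ n - 1 ∧ Nat.gcd r n = 1 ∧
      A = RatFunc.X ^ r * R ^ n ∧ F = RatFunc.X ^ r * rcomp R (RatFunc.X ^ n)) := by
  have hn0 : n ≠ 0 := by omega
  have hζ0 : ζ ≠ 0 := hζ.ne_zero hn0
  have hX : (RatFunc.X : RatFunc ℂ) ≠ 0 := RatFunc.X_ne_zero
  have hCζ : RatFunc.C ζ ≠ 0 := (_root_.map_ne_zero _).2 hζ0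
  simp only [← substHom_apply _ (aeval_X_pow_injective hn0),
    ← substHom_apply _ (aeval_C_mul_X_injective hζ0)]
  set τ := substHom _ (aeval_X_pow_injective hn0)
  set σ := substHom _ (aeval_C_mul_X_injective hζ0)
  have hτX : τ RatFunc.X = RatFunc.X ^ n := substHom_X _ _
  have hσX : σ RatFunc.X = RatFunc.C ζ * RatFunc.X := substHom_X _ _
  constructor
  · rintro ⟨h_comp, r, hr, h_rot⟩
    have hn' : (n : ℤ) ≠ 0 := by exact_mod_cast hn0
    obtain ⟨k, hk⟩ := Int.eq_ofNat_of_zero_le (Int.emod_nonneg r hn')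
    have hk_lt : k < n := by
      have := Int.emod_lt_of_pos r (show (0 : ℤ) < n by omega)
      omega
    have hk_gcd : Nat.gcd k n = 1 := by
      rw [← Int.gcd_natCast_natCast, ← hk, Int.gcd_emod, hr]
    have h_pow : ζ ^ r = ζ ^ k := by
      rw [← Int.emod_add_mul_ediv r n, hk, zpow_add₀ hζ0, zpow_mul, zpow_natCast, zpow_natCast,
        hζ.pow_eq_one, one_zpow, mul_one]
    have h_inv : σ (F / RatFunc.X ^ k) = F / RatFunc.X ^ k := by
      rw [map_div₀, map_pow, hσX, h_rot, h_pow, map_pow, mul_pow,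
        mul_div_mul_left _ _ (pow_ne_zero k hCζ)]
    obtain ⟨R, hR⟩ := exists_rcomp_X_pow_of_rcomp_eq hn0 hζ
      ((substHom_apply _ _ _).symm.trans h_inv)
    rw [← substHom_apply _ (aeval_X_pow_injective hn0), div_eq_iff (pow_ne_zero k hX), mul_comm]
      at hR
    refine ⟨R, k, by omega, hk_gcd, ?_, hR⟩
    apply τ.toRingHom.injective
    change τ A = τ (RatFunc.X ^ k * R ^ n)
    rw [h_comp, hR, map_mul, map_pow, map_pow, hτX, mul_pow, ← pow_mul, ← pow_mul, mul_comm k n]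
  · rintro ⟨R, r, -, hr, rfl, hF'⟩
    have hστ : σ (τ R) = τ R := by
      have h_fix : σ (RatFunc.X ^ n) = RatFunc.X ^ n := by
        rw [map_pow, hσX, mul_pow, ← map_pow, hζ.pow_eq_one, map_one, one_mul]
      simp only [τ, substHom_apply _ (aeval_X_pow_injective hn0), rcomp, map_div₀,
        ← Polynomial.aeval_algHom_apply, h_fix]
    refine ⟨?_, r, by rwa [Int.gcd_natCast_natCast], ?_⟩
    · rw [hF', map_mul, map_pow, map_pow, hτX, mul_pow, ← pow_mul, ← pow_mul, mul_comm r n]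
    · rw [hF', map_mul, hστ, map_pow, hσX, zpow_natCast, map_pow, mul_pow, mul_assoc]

end GenLattes
end
end

section
/- Let n > 2, let ζ be a primitive n-th root of unity in ℂ, and let F ∈ ℂ(X) be a nonconstant rational function satisfying F(ζX) = ζ^r · F(X) for some integer r with gcd(r, n) = 1, and F(X) · F(X⁻¹) = ζ^k for some integer k. Set m = deg F. Then m ≥ n + 1, unless F = ε·X^m or F = ε·X^{−m} for some ε ∈ ℂ with ε^{2n} = 1; and in this exceptional case the unique rational function A with A((X^n + X^{−n})/2) = (F(X)^n + F(X)^{−n})/2 equals ε^n · T_m. -/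
open Polynomial OnePoint
open scoped Classical

noncomputable section

namespace GenLattes

/-- If `p / q` in lowest terms is multiplied by a constant under the substitution `X ↦ ζ X`,
then so is `p`. -/
lemma exists_comp_eq_C_mul {p q : ℂ[X]} (hpq : IsCoprime p q) (hp : p ≠ 0) {ζ c : ℂ}
    (hζ : ζ ≠ 0) (h : p.comp (C ζ * X) * q = C c * (p * q.comp (C ζ * X))) :
    ∃ a : ℂ, p.comp (C ζ * X) = C a * p := by
  obtain ⟨u, hu⟩ : p ∣ p.comp (C ζ * X) :=
    hpq.dvd_of_dvd_mul_right ⟨C c * q.comp (C ζ * X), by rw [h]; ring⟩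
  have hdeg : (p.comp (C ζ * X)).natDegree = p.natDegree := by
    rw [natDegree_comp, natDegree_C_mul_X _ hζ, mul_one]
  have hu0 : u ≠ 0 := by
    rintro rfl
    rw [mul_zero, comp_C_mul_X_eq_zero_iff (mem_nonZeroDivisors_of_ne_zero hζ)] at hu
    exact hp hu
  rw [hu, natDegree_mul hp hu0] at hdeg
  refine ⟨u.coeff 0, ?_⟩
  rw [hu, ← eq_C_of_natDegree_eq_zero (by omega), mul_comm]

/-- If the zero set of `p` is stable under multiplication by a primitive `n`-th root of unity
and contains a nonzero point, then it contains `n` nonzero points. -/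
lemma natDegree_of_comp_eq_C_mul {n : ℕ} {ζ a w : ℂ} (hζ : IsPrimitiveRoot ζ n) (hn : n ≠ 0)
    {p : ℂ[X]} (hp : p ≠ 0) (h : p.comp (C ζ * X) = C a * p) (hw : w ≠ 0)
    (hpw : p.eval w = 0) :
    n ≤ p.natDegree ∧ (p.eval 0 = 0 → n + 1 ≤ p.natDegree) := by
  have hroot : ∀ i : ℕ, p.eval (ζ ^ i * w) = 0 := by
    intro i
    induction i with
    | zero => simpa
    | succ i ih =>
      have := congrArg (eval (ζ ^ i * w)) h
      simp only [eval_comp, eval_mul, eval_C, eval_X, ih, mul_zero] at this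
      rw [pow_succ', mul_assoc, this]
  set Z : Finset ℂ := (Finset.range n).image fun i => ζ ^ i * w
  have hZ : Z.card = n := by
    rw [Finset.card_image_of_injOn, Finset.card_range]
    intro i hi j hj hij
    exact hζ.pow_inj (by simpa using hi) (by simpa using hj) (mul_right_cancel₀ hw hij)
  have hZroot : ∀ z ∈ Z, p.eval z = 0 := by
    intro z hz
    obtain ⟨i, -, rfl⟩ := Finset.mem_image.1 hz
    exact hroot i
  have h0 : (0 : ℂ) ∉ Z := by
    intro hz
    obtain ⟨i, -, hi⟩ := Finset.mem_image.1 hz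
    exact mul_ne_zero (pow_ne_zero i (hζ.ne_zero hn)) hw hi
  constructor
  · rw [← hZ]
    exact card_le_degree_of_subset_roots fun z hz => (mem_roots hp).2 (hZroot z hz)
  · intro hp0
    rw [← hZ, ← Finset.card_insert_of_notMem h0]
    refine card_le_degree_of_subset_roots fun z hz => (mem_roots hp).2 ?_
    rcases Finset.mem_insert.1 (Finset.mem_def.2 hz) with rfl | hz
    · exact hp0
    · exact hZroot z hz

/-- A complex polynomial all of whose roots are zero is a monomial. -/
lemma eq_C_mul_X_pow {p : ℂ[X]} (h : ∀ w, p.eval w = 0 → w = 0) :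
    p = C p.leadingCoeff * X ^ p.natDegree := by
  rcases eq_or_ne p 0 with rfl | hp
  · simp
  have hs := IsAlgClosed.splits p
  have hr : p.roots = Multiset.replicate p.natDegree 0 := by
    rw [Multiset.eq_replicate]
    exact ⟨hs.natDegree_eq_card_roots.symm, fun z hz => h z ((mem_roots hp).1 hz)⟩
  conv_lhs => rw [hs.eq_prod_roots, hr]
  simp

lemma aeval_inv_X_mul_pow (p : ℂ[X]) :
    aeval (RatFunc.X : RatFunc ℂ)⁻¹ p * RatFunc.X ^ p.natDegree =
      algebraMap ℂ[X] (RatFunc ℂ) p.reverse := by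
  have hX : (RatFunc.X : RatFunc ℂ) ≠ 0 := RatFunc.X_ne_zero
  let : Invertible (RatFunc.X : RatFunc ℂ)⁻¹ := invertibleOfNonzero (inv_ne_zero hX)
  have h := eval₂_reverse_mul_pow (algebraMap ℂ (RatFunc ℂ)) (RatFunc.X : RatFunc ℂ)⁻¹ p
  rw [invOf_eq_inv, inv_inv, ← aeval_def, ← aeval_def, RatFunc.aeval_X_left_eq_algebraMap] at h
  rw [← h, mul_assoc, ← mul_pow, inv_mul_cancel₀ hX, one_pow, mul_one]

lemma aeval_C_mul_X (ζ : ℂ) (p : ℂ[X]) :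
    aeval (RatFunc.C ζ * RatFunc.X : RatFunc ℂ) p =
      algebraMap ℂ[X] (RatFunc ℂ) (p.comp (C ζ * X)) := by
  rw [← RatFunc.aeval_X_left_eq_algebraMap, aeval_comp]
  simp

lemma mul_denom_eq_num (F : RatFunc ℂ) :
    F * algebraMap ℂ[X] (RatFunc ℂ) F.denom = algebraMap ℂ[X] (RatFunc ℂ) F.num := by
  rw [← div_eq_iff_mul_eq (RatFunc.algebraMap_ne_zero F.denom_ne_zero)]
  exact RatFunc.num_div_denom F

lemma num_comp_mul_denom {F : RatFunc ℂ} {ζ c : ℂ} (hζ : ζ ≠ 0)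
    (h : rcomp F (RatFunc.C ζ * RatFunc.X) = RatFunc.C c * F) :
    F.num.comp (C ζ * X) * F.denom = C c * (F.num * F.denom.comp (C ζ * X)) := by
  have hd : algebraMap ℂ[X] (RatFunc ℂ) (F.denom.comp (C ζ * X)) ≠ 0 :=
    RatFunc.algebraMap_ne_zero <|
      (comp_C_mul_X_eq_zero_iff (mem_nonZeroDivisors_of_ne_zero hζ)).not.2 F.denom_ne_zero
  rw [rcomp, aeval_C_mul_X, aeval_C_mul_X, div_eq_iff hd] at h
  apply RatFunc.algebraMap_injective ℂ
  simp only [map_mul, h, RatFunc.algebraMap_C, ← mul_denom_eq_num F]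
  ring

lemma num_mul_reverse {F : RatFunc ℂ} {c : ℂ}
    (h : F * rcomp F RatFunc.X⁻¹ = RatFunc.C c) :
    F.num * F.num.reverse * X ^ F.denom.natDegree =
      C c * (F.denom * F.denom.reverse * X ^ F.num.natDegree) := by
  have hX : (RatFunc.X : RatFunc ℂ) ≠ 0 := RatFunc.X_ne_zero
  have hd : aeval (RatFunc.X : RatFunc ℂ)⁻¹ F.denom ≠ 0 := by
    intro h0
    have := aeval_inv_X_mul_pow F.denom
    rw [h0, zero_mul, eq_comm] at this
    exact RatFunc.algebraMap_ne_zero (mt reverse_eq_zero.1 F.denom_ne_zero) this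
  rw [rcomp, mul_div_assoc', div_eq_iff hd] at h
  apply RatFunc.algebraMap_injective ℂ
  simp only [map_mul, map_pow, RatFunc.algebraMap_C, RatFunc.algebraMap_X,
    ← mul_denom_eq_num F, ← aeval_inv_X_mul_pow]
  linear_combination (algebraMap ℂ[X] (RatFunc ℂ) F.denom * RatFunc.X ^ F.num.natDegree *
    RatFunc.X ^ F.denom.natDegree) * h

lemma eval_inv_eq_zero_of_reverse {p : ℂ[X]} {w : ℂ} (hw : w ≠ 0)
    (h : p.reverse.eval w = 0) : p.eval w⁻¹ = 0 := by
  let : Invertible w⁻¹ := invertibleOfNonzero (inv_ne_zero hw)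
  have := (eval₂_reverse_eq_zero_iff (RingHom.id ℂ) w⁻¹ p).1
  rw [invOf_eq_inv, inv_inv] at this
  exact this h

/-- Nonzero roots of `p` give nonzero roots of `q` by inversion. -/
lemma exists_root_of_root {p q s : ℂ[X]} (hpq : IsCoprime p q) {c : ℂ} (hc : c ≠ 0) {i j : ℕ}
    (h : p * s * X ^ i = C c * (q * q.reverse * X ^ j)) {w : ℂ} (hw : w ≠ 0)
    (hpw : p.eval w = 0) : ∃ v, v ≠ 0 ∧ q.eval v = 0 := by
  refine ⟨w⁻¹, inv_ne_zero hw, eval_inv_eq_zero_of_reverse hw ?_⟩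
  have hq : q.eval w ≠ 0 := by
    intro hq
    obtain ⟨a, b, hab⟩ := hpq
    simpa [hpw, hq] using congrArg (eval w) hab
  have := congrArg (eval w) h
  simpa [hpw, hq, hc, hw] using this

lemma rcomp_eq_aeval_iff {g : RatFunc ℂ} (hg : Transcendental ℂ g) (A : RatFunc ℂ) (P : ℂ[X]) :
    rcomp A g = aeval g P ↔ A = algebraMap ℂ[X] (RatFunc ℂ) P := by
  constructor
  · intro h
    have hd : aeval g A.denom ≠ 0 :=
      (map_ne_zero_iff _ (transcendental_iff_injective.1 hg)).2 A.denom_ne_zero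
    rw [rcomp, div_eq_iff hd, ← map_mul] at h
    have h' := transcendental_iff_injective.1 hg h
    rw [← RatFunc.num_div_denom A, h', map_mul]
    exact mul_div_cancel_right₀ _ (RatFunc.algebraMap_ne_zero A.denom_ne_zero)
  · rintro rfl
    simp [rcomp]

lemma transcendental_joukowski {n : ℕ} (hn : n ≠ 0) :
    Transcendental ℂ ((RatFunc.X ^ n + (RatFunc.X ^ n)⁻¹) / 2 : RatFunc ℂ) := by
  apply RatFunc.transcendental_of_ne_C
  rintro ⟨c, hc⟩
  have hX : (RatFunc.X : RatFunc ℂ) ^ n ≠ 0 := pow_ne_zero _ RatFunc.X_ne_zero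
  field_simp at hc
  have h : (X ^ n) ^ 2 + 1 = (2 * C c * X ^ n : ℂ[X]) := by
    apply RatFunc.algebraMap_injective ℂ
    simp only [map_add, map_mul, map_pow, RatFunc.algebraMap_C, RatFunc.algebraMap_X, map_one,
      map_ofNat]
    linear_combination hc
  simpa [hn] using congrArg (eval 0) h

lemma aeval_T_joukowski {K : Type*} [Field K] [Algebra ℂ K] {y : K} (hy : y ≠ 0) (m : ℕ) :
    aeval ((y + y⁻¹) / 2) (Polynomial.Chebyshev.T ℂ m) = (y ^ m + (y ^ m)⁻¹) / 2 := by
  have : CharZero K := charZero_of_injective_algebraMap (algebraMap ℂ K).injective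
  induction m using Nat.twoStepInduction with
  | zero => simp
  | one => simp
  | more m ih1 ih2 =>
    push_cast at ih2 ⊢
    rw [Polynomial.Chebyshev.T_add_two, map_sub, map_mul, map_mul, ih1, ih2]
    simp only [aeval_X, map_ofNat]
    field_simp
    ring

/-- For `F = ε X^{±m}` with `ε^{2n} = 1`, the unique `A` with
`A((X^n + X^{-n})/2) = (F^n + F^{-n})/2` is `ε^n T_m`. -/
lemma rcomp_joukowski_iff {n : ℕ} (hn : n ≠ 0) {ε : ℂ} (hε : ε ^ (2 * n) = 1)
    {F : RatFunc ℂ} {m : ℕ}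
    (hF : F = RatFunc.C ε * RatFunc.X ^ m ∨ F = RatFunc.C ε * (RatFunc.X ^ m)⁻¹)
    (A : RatFunc ℂ) :
    rcomp A ((RatFunc.X ^ n + (RatFunc.X ^ n)⁻¹) / 2) = (F ^ n + (F ^ n)⁻¹) / 2 ↔
      A = RatFunc.C (ε ^ n) * chebyRF m := by
  have hX : (RatFunc.X : RatFunc ℂ) ^ n ≠ 0 := pow_ne_zero _ RatFunc.X_ne_zero
  have hε' : (RatFunc.C ε ^ n : RatFunc ℂ)⁻¹ = RatFunc.C ε ^ n := by
    apply inv_eq_of_mul_eq_one_left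
    rw [← pow_add, ← two_mul, ← map_pow, hε, map_one]
  have key : (F ^ n + (F ^ n)⁻¹) / 2 = aeval ((RatFunc.X ^ n + (RatFunc.X ^ n)⁻¹) / 2)
      (C (ε ^ n) * Polynomial.Chebyshev.T ℂ m) := by
    rw [map_mul, aeval_T_joukowski hX, aeval_C, RatFunc.algebraMap_eq_C, map_pow,
      ← pow_mul, mul_comm n m, pow_mul]
    rcases hF with rfl | rfl
    · rw [mul_pow, mul_inv, hε']
      ring
    · rw [mul_pow, mul_inv, hε', inv_pow, inv_inv]
      ring
  rw [key, rcomp_eq_aeval_iff (transcendental_joukowski hn), map_mul, RatFunc.algebraMap_C,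
    chebyRF]

/-- **Corollary (degree bound in the dihedral case).** With `m = deg F`, one has
`m ≥ n + 1` unless `F = ε X^{±m}` with `ε^{2n} = 1`, in which case the unique `A` with
`A((X^n + X^{-n})/2) = (F^n + F^{-n})/2` equals `ε^n T_m`. -/
theorem degree_bound_dihedral (n : ℕ) (hn : 2 < n) (ζ : ℂ) (hζ : IsPrimitiveRoot ζ n)
    (F : RatFunc ℂ) (hF : 1 ≤ rdeg F)
    (r : ℤ) (hr : Int.gcd r n = 1)
    (h1 : rcomp F (RatFunc.C ζ * RatFunc.X) = RatFunc.C (ζ ^ r) * F)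
    (k : ℤ) (h2 : F * rcomp F RatFunc.X⁻¹ = RatFunc.C (ζ ^ k)) :
    n + 1 ≤ rdeg F ∨
      ∃ ε : ℂ, ε ^ (2 * n) = 1 ∧
        (F = RatFunc.C ε * RatFunc.X ^ rdeg F ∨
          F = RatFunc.C ε * (RatFunc.X ^ rdeg F)⁻¹) ∧
        ∀ A : RatFunc ℂ,
          (rcomp A ((RatFunc.X ^ n + (RatFunc.X ^ n)⁻¹) / 2) =
              (F ^ n + (F ^ n)⁻¹) / 2 ↔
            A = RatFunc.C (ε ^ n) * chebyRF (rdeg F)) := by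
  have hn0 : n ≠ 0 := by omega
  have hζ0 : ζ ≠ 0 := hζ.ne_zero hn0
  have hc : ζ ^ k ≠ 0 := zpow_ne_zero _ hζ0
  have hp : F.num ≠ 0 := by
    intro h
    rw [RatFunc.num_eq_zero_iff.1 h, zero_mul, eq_comm, map_eq_zero] at h2
    exact hc h2
  have hq : F.denom ≠ 0 := F.denom_ne_zero
  have hpq := F.isCoprime_num_denom
  have hcomp := num_comp_mul_denom hζ0 h1
  have hrev := num_mul_reverse h2
  obtain ⟨a, ha⟩ := exists_comp_eq_C_mul hpq hp hζ0 hcomp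
  obtain ⟨b, hb⟩ : ∃ b : ℂ, F.denom.comp (C ζ * X) = C b * F.denom := by
    refine exists_comp_eq_C_mul (c := (ζ ^ r)⁻¹) hpq.symm hq hζ0 ?_
    have : (C (ζ ^ r)⁻¹ * C (ζ ^ r) : ℂ[X]) = 1 := by
      rw [← C_mul, inv_mul_cancel₀ (zpow_ne_zero _ hζ0), C_1]
    linear_combination (-C (ζ ^ r)⁻¹) * hcomp - (F.denom.comp (C ζ * X) * F.num) * this
  by_cases hroot : ∃ w, w ≠ 0 ∧ F.num.eval w = 0 ∨ w ≠ 0 ∧ F.denom.eval w = 0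
  · left
    obtain ⟨⟨v, hv, hpv⟩, u, hu, hqu⟩ :
        (∃ v, v ≠ 0 ∧ F.num.eval v = 0) ∧ ∃ u, u ≠ 0 ∧ F.denom.eval u = 0 := by
      obtain ⟨w, ⟨hw, hpw⟩ | ⟨hw, hqw⟩⟩ := hroot
      · exact ⟨⟨w, hw, hpw⟩, exists_root_of_root hpq hc hrev hw hpw⟩
      · refine ⟨exists_root_of_root hpq.symm (s := F.denom.reverse) (i := F.num.natDegree)
          (j := F.denom.natDegree) (inv_ne_zero hc) ?_ hw hqw, w, hw, hqw⟩
        have : (C (ζ ^ k)⁻¹ * C (ζ ^ k) : ℂ[X]) = 1 := by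
          rw [← C_mul, inv_mul_cancel₀ hc, C_1]
        linear_combination (-C (ζ ^ k)⁻¹) * hrev -
          (F.denom * F.denom.reverse * X ^ F.num.natDegree) * this
    have hP := natDegree_of_comp_eq_C_mul hζ hn0 hp ha hv hpv
    have hQ := natDegree_of_comp_eq_C_mul hζ hn0 hq hb hu hqu
    by_cases hp0 : F.num.eval 0 = 0
    · exact (hP.2 hp0).trans (le_max_left _ _)
    by_cases hq0 : F.denom.eval 0 = 0
    · exact (hQ.2 hq0).trans (le_max_right _ _)
    exfalso
    have hr1 : ζ ^ r = 1 := by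
      have := congrArg (eval 0) hcomp
      simp only [eval_mul, eval_comp, eval_C, eval_X, mul_zero] at this
      exact (mul_right_cancel₀ (mul_ne_zero hp0 hq0) (by rw [one_mul]; exact this)).symm
    rw [hζ.zpow_eq_one_iff_dvd] at hr1
    have := Int.dvd_gcd hr1 dvd_rfl
    rw [hr] at this
    have := Nat.le_of_dvd one_pos this
    omega
  · right
    push Not at hroot
    have hpX := eq_C_mul_X_pow fun w hw => by_contra fun h => (hroot w).1 h hw
    have hqX := eq_C_mul_X_pow fun w hw => by_contra fun h => (hroot w).2 h hw
    rw [F.monic_denom.leadingCoeff, C_1, one_mul] at hqX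
    set ε := F.num.leadingCoeff
    have hε : ε ^ (2 * n) = 1 := by
      have hone : ∀ p : ℂ[X], p.reverse.eval 1 = p.eval 1 := fun p => by
        let : Invertible (1 : ℂ) := invertibleOne
        simpa [eval₂_eq_eval_map] using eval₂_reverse_mul_pow (RingHom.id ℂ) 1 p
      have h := congrArg (eval 1) hrev
      simp only [eval_mul, hone, eval_C, eval_pow, eval_X, one_pow, mul_one] at h
      rw [hpX, hqX] at h
      simp only [eval_mul, eval_C, eval_pow, eval_X, one_pow, mul_one] at h
      rw [pow_mul, sq, h, ← zpow_natCast, ← zpow_mul, mul_comm, zpow_mul, zpow_natCast,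
        hζ.pow_eq_one, one_zpow]
    have hform : F = RatFunc.C ε * RatFunc.X ^ rdeg F ∨
        F = RatFunc.C ε * (RatFunc.X ^ rdeg F)⁻¹ := by
      have hFX : F = RatFunc.C ε * RatFunc.X ^ F.num.natDegree /
          RatFunc.X ^ F.denom.natDegree := by
        conv_lhs => rw [← RatFunc.num_div_denom F, hpX, hqX]
        simp
      have h0 : F.num.natDegree = 0 ∨ F.denom.natDegree = 0 := by
        by_contra! h
        obtain ⟨x, y, hxy⟩ := hpq
        rw [hpX, hqX] at hxy
        simpa [h.1, h.2] using congrArg (eval 0) hxy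
      rcases h0 with h | h
      · right
        rw [rdeg, h, Nat.zero_max]
        simpa [h, div_eq_mul_inv] using hFX
      · left
        rw [rdeg, h, Nat.max_zero]
        simpa [h] using hFX
    exact ⟨ε, hε, hform, rcomp_joukowski_iff hn0 hε hform⟩

end GenLattes
end
end

section
/- Let A be a polynomial of degree at least two such that A : O → O is a minimal holomorphic map between orbifolds for some nontrivial orbifold O on ℂP¹. Then either there exist an integer n ≥ 2, an integer r ≥ 0 with gcd(r, n) = 1, and a polynomial R ∈ ℂ[z] such that A is conjugate to z^r · R(z)^n, or A is conjugate to T_m or to −T_m, where m = deg A. -/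
open Polynomial OnePoint
open scoped Classical

noncomputable section

namespace GenLattes

lemma rcomp_algebraMap (p q : ℂ[X]) :
    rcomp (algebraMap ℂ[X] (RatFunc ℂ) p) (algebraMap ℂ[X] (RatFunc ℂ) q) =
      algebraMap ℂ[X] (RatFunc ℂ) (p.comp q) := by
  rw [rcomp, RatFunc.num_algebraMap, RatFunc.denom_algebraMap, map_one, div_one,
    Polynomial.comp_eq_aeval, Polynomial.aeval_algebraMap_apply]

/-- Polynomials that are conjugate by an affine change of variable are conjugate. -/
lemma conjugate_of_affine {P B : ℂ[X]} {α β : ℂ} (hα : α ≠ 0)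
    (h : P.comp (C α * X + C β) = C α * B + C β) :
    Conjugate (algebraMap ℂ[X] (RatFunc ℂ) P) (algebraMap ℂ[X] (RatFunc ℂ) B) := by
  have hinv : (C α * X + C β : ℂ[X]).comp (C α⁻¹ * (X - C β)) = X := by
    simp [← mul_assoc, ← C_mul, hα]
  refine ⟨algebraMap _ _ (C α * X + C β), algebraMap _ _ (C α⁻¹ * (X - C β)), ?_, ?_, ?_⟩
  · rw [rcomp_algebraMap, hinv, RatFunc.algebraMap_X]
  · rw [rcomp_algebraMap, ← RatFunc.algebraMap_X]
    simp [← mul_assoc, ← C_mul, hα]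
  · rw [rcomp_algebraMap, rcomp_algebraMap]
    congr 1
    rw [show (C α * X + C β : ℂ[X]).comp B = P.comp (C α * X + C β) by simp [h],
      comp_assoc, hinv, comp_X]

lemma evalOP_algebraMap_coe (P : ℂ[X]) (z : ℂ) :
    evalOP (algebraMap ℂ[X] (RatFunc ℂ) P) (z : OnePoint ℂ) = ((P.eval z : ℂ) : OnePoint ℂ) := by
  change evalF _ z = _
  simp [evalF]

lemma locDeg_algebraMap_coe (P : ℂ[X]) (z : ℂ) :
    locDeg (algebraMap ℂ[X] (RatFunc ℂ) P) (z : OnePoint ℂ) =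
      rootMultiplicity z (P - C (P.eval z)) := by
  change locDegF _ z = _
  simp [locDegF]

/-- A complex polynomial all of whose root multiplicities are divisible by `n ≠ 0` is an
`n`-th power. -/
lemma exists_eq_pow_of_dvd_rootMultiplicity {Q : ℂ[X]} {n : ℕ} (hn : n ≠ 0)
    (h : ∀ z, n ∣ rootMultiplicity z Q) : ∃ R : ℂ[X], Q = R ^ n := by
  obtain ⟨c, hc⟩ := IsAlgClosed.exists_pow_nat_eq Q.leadingCoeff (Nat.pos_of_ne_zero hn)
  refine ⟨C c * ∏ z ∈ Q.roots.toFinset, (X - C z) ^ (rootMultiplicity z Q / n), ?_⟩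
  conv_lhs => rw [(IsAlgClosed.splits Q).eq_prod_roots]
  rw [mul_pow, ← C_pow, hc, Finset.prod_multiset_map_count, ← Finset.prod_pow]
  congr 1
  refine Finset.prod_congr rfl fun z _ => ?_
  rw [← pow_mul, Nat.div_mul_cancel (h z), count_roots]

/-- The Chebyshev differential equation determines the Chebyshev polynomial up to scaling. -/
lemma eq_C_mul_T_of_ode {B : ℂ[X]} {d : ℕ} (hd : B.natDegree = d)
    (h : (d ^ 2 : ℂ[X]) * B = X * derivative B + (X ^ 2 - 1) * derivative (derivative B)) :
    ∃ c : ℂ, B = C c * Chebyshev.T ℂ d := by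
  have hT := Chebyshev.one_sub_X_sq_mul_derivative_derivative_T_eq_poly_in_T (R := ℂ) (d : ℤ)
  simp only [Function.iterate_succ, Function.iterate_zero, Function.comp_apply, id] at hT
  push_cast at hT
  have hTd : (Chebyshev.T ℂ d).natDegree = d := by simp [Chebyshev.natDegree_T]
  have hTl : (Chebyshev.T ℂ d).coeff d ≠ 0 := by
    intro h0
    have : (Chebyshev.T ℂ d).leadingCoeff = 0 := by rw [leadingCoeff, hTd, h0]
    have := leadingCoeff_eq_zero.mp this
    have h1 := Chebyshev.T_eval_one (R := ℂ) (d : ℤ)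
    simp [this] at h1
  set c := B.coeff d / (Chebyshev.T ℂ d).coeff d with hc
  refine ⟨c, ?_⟩
  set D := B - C c * Chebyshev.T ℂ d with hD
  rw [← sub_eq_zero, ← hD]
  by_contra hD0
  have hDd : D.coeff d = 0 := by
    rw [hD, coeff_sub, coeff_C_mul, hc, div_mul_cancel₀ _ hTl, sub_self]
  have hDle : D.natDegree ≤ d := by
    refine (natDegree_sub_le _ _).trans (max_le hd.le ?_)
    exact (natDegree_C_mul_le _ _).trans hTd.le
  have hDode : (d ^ 2 : ℂ[X]) * D =
      X * derivative D + (X ^ 2 - 1) * derivative (derivative D) := by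
    rw [hD]
    simp only [derivative_sub, derivative_C_mul]
    linear_combination h - C c * hT
  have hlt : D.natDegree < d := by
    refine lt_of_le_of_ne hDle fun he => hD0 ?_
    rw [← leadingCoeff_eq_zero, leadingCoeff, he, hDd]
  have hlc : D.coeff D.natDegree ≠ 0 := by simpa using hD0
  have hco := congrArg (fun p => p.coeff D.natDegree) hDode
  have hd1 : (X * derivative D).coeff D.natDegree = D.natDegree * D.coeff D.natDegree := by
    rcases D.natDegree with _ | m
    · simp
    · rw [coeff_X_mul, coeff_derivative]; push_cast; ring
  have hd2 : ((X ^ 2 - 1) * derivative (derivative D)).coeff D.natDegree =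
      D.natDegree * (D.natDegree - 1) * D.coeff D.natDegree := by
    have hz : (derivative (derivative D)).coeff D.natDegree = 0 := by
      rw [coeff_derivative, coeff_derivative, coeff_eq_zero_of_natDegree_lt (by omega)]; simp
    rw [sub_mul, one_mul, coeff_sub, hz, sub_zero]
    rcases D.natDegree with _ | _ | m
    · simp
    · simp [coeff_X_pow_mul']
    · rw [coeff_X_pow_mul, coeff_derivative, coeff_derivative]; push_cast; ring
  have hd3 : ((d ^ 2 : ℂ[X]) * D).coeff D.natDegree = d ^ 2 * D.coeff D.natDegree := by
    rw [← coeff_C_mul]; simp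
  simp only [coeff_add, hd1, hd2, hd3] at hco
  have hsq : (d : ℂ) ^ 2 = (D.natDegree : ℂ) ^ 2 :=
    mul_right_cancel₀ hlc (by linear_combination hco)
  norm_cast at hsq
  exact hlt.ne' (Nat.pow_left_injective two_ne_zero hsq)

/-- Polynomials satisfying the Pell-type equation `c (B² - 1) = B'² (X² - 1)` are Chebyshev
polynomials up to sign. -/
lemma eq_T_or_neg_T {B : ℂ[X]} {c : ℂ} (hB : B.natDegree ≠ 0) (hc : c ≠ 0)
    (h : C c * (B ^ 2 - 1) = derivative B ^ 2 * (X ^ 2 - 1)) :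
    B = Chebyshev.T ℂ B.natDegree ∨ B = -Chebyshev.T ℂ B.natDegree := by
  obtain ⟨d, hd⟩ : ∃ d, B.natDegree = d := ⟨_, rfl⟩
  have hB' : derivative B ≠ 0 := fun h0 => hB (derivative_eq_zero.mp h0)
  have hB0 : B.leadingCoeff ≠ 0 := by
    rw [Ne, leadingCoeff_eq_zero]; rintro rfl; simp at hB
  have hcd : c = d ^ 2 := by
    have h1 := congrArg leadingCoeff h
    have e1 : (B ^ 2 - 1).leadingCoeff = B.leadingCoeff ^ 2 := by
      rw [leadingCoeff_sub_of_degree_lt, leadingCoeff_pow]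
      rw [degree_one, ← natDegree_pos_iff_degree_pos, natDegree_pow]; omega
    have e2 : (X ^ 2 - 1 : ℂ[X]).leadingCoeff = 1 := by
      exact leadingCoeff_X_pow_sub_one (by norm_num)
    have e3 : (derivative B).leadingCoeff = B.leadingCoeff * d := by
      rw [leadingCoeff, natDegree_derivative, coeff_derivative, leadingCoeff, hd]
      rw [Nat.sub_add_cancel (by omega)]
      congr 1
      norm_cast
      omega
    rw [leadingCoeff_mul, leadingCoeff_mul, leadingCoeff_C, leadingCoeff_pow, e1, e2, e3] at h1
    have : B.leadingCoeff ^ 2 * (c - d ^ 2) = 0 := by linear_combination h1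
    rcases mul_eq_zero.mp this with h2 | h2
    · exact absurd h2 (pow_ne_zero _ hB0)
    · exact sub_eq_zero.mp h2
  have hode : (d ^ 2 : ℂ[X]) * B = X * derivative B + (X ^ 2 - 1) * derivative (derivative B) := by
    have h1 := congrArg derivative h
    simp only [derivative_mul, derivative_natCast, derivative_sub, derivative_one, derivative_pow,
      derivative_X, hcd, map_pow, map_natCast] at h1
    have h2 : (2 * derivative B) * ((d ^ 2 : ℂ[X]) * B -
        (X * derivative B + (X ^ 2 - 1) * derivative (derivative B))) = 0 := by
      push_cast at h1
      linear_combination h1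
    rcases mul_eq_zero.mp h2 with h3 | h3
    · exact absurd h3 (mul_ne_zero two_ne_zero hB')
    · exact sub_eq_zero.mp h3
  obtain ⟨k, hk⟩ := eq_C_mul_T_of_ode hd hode
  rw [hd]
  have h1 := congrArg (eval 1) h
  rw [hk] at h1
  simp [Chebyshev.T_eval_one, hc] at h1
  have : (k - 1) * (k + 1) = 0 := by linear_combination h1
  rcases mul_eq_zero.mp this with h2 | h2
  · left; rw [hk, sub_eq_zero.mp h2]; simp
  · right; rw [hk, eq_neg_of_add_eq_zero_left h2]; simp

/-- The case of a ramification locus with a single finite point. -/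
lemma exists_conjugate_X_pow_mul_pow {P : ℂ[X]} (hP : P.natDegree ≠ 0)
    {a : ℂ} {n : ℕ} (hn : n ≠ 0)
    (hcop : Nat.gcd (rootMultiplicity a (P - C a)) n = 1)
    (hdvd : ∀ z, z ≠ a → n ∣ rootMultiplicity z (P - C a)) :
    ∃ (r : ℕ) (R : ℂ[X]), Nat.gcd r n = 1 ∧
      Conjugate (algebraMap ℂ[X] (RatFunc ℂ) P)
        (RatFunc.X ^ r * (algebraMap ℂ[X] (RatFunc ℂ) R) ^ n) := by
  have h0 : P - C a ≠ 0 := by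
    intro h
    rw [sub_eq_zero.mp h] at hP
    simp at hP
  obtain ⟨Q, hQ, hQa⟩ := exists_eq_pow_rootMultiplicity_mul_and_not_dvd _ h0 a
  set r := rootMultiplicity a (P - C a) with hr
  have hQm : ∀ z, n ∣ rootMultiplicity z Q := by
    intro z
    by_cases hz : z = a
    · subst hz
      rw [rootMultiplicity_eq_zero]
      · exact dvd_zero _
      · rwa [← dvd_iff_isRoot]
    · have h1 := hdvd z hz
      rwa [hQ, rootMultiplicity_mul (hQ ▸ h0), rootMultiplicity_eq_zero (p := (X - C a) ^ r),
        zero_add] at h1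
      simp [IsRoot, sub_eq_zero, hz]
  obtain ⟨R, hR⟩ := exists_eq_pow_of_dvd_rootMultiplicity hn hQm
  refine ⟨r, R.comp (X + C a), hcop, ?_⟩
  rw [← RatFunc.algebraMap_X, ← map_pow, ← map_pow, ← map_mul]
  apply conjugate_of_affine (α := 1) (β := a) one_ne_zero
  rw [eq_add_of_sub_eq hQ, hR]
  simp

/-- The case of a ramification locus with two finite points. -/
lemma conjugate_T_or_neg_T {P : ℂ[X]} (hP : P.natDegree ≠ 0) {a b c : ℂ} (hab : a ≠ b)
    (hc : c ≠ 0)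
    (h : C c * ((P - C a) * (P - C b)) = derivative P ^ 2 * ((X - C a) * (X - C b))) :
    Conjugate (algebraMap ℂ[X] (RatFunc ℂ) P)
      (algebraMap ℂ[X] (RatFunc ℂ) (Chebyshev.T ℂ P.natDegree)) ∨
    Conjugate (algebraMap ℂ[X] (RatFunc ℂ) P)
      (algebraMap ℂ[X] (RatFunc ℂ) (-Chebyshev.T ℂ P.natDegree)) := by
  obtain ⟨α, hα⟩ : ∃ α, α = (a - b) / 2 := ⟨_, rfl⟩
  obtain ⟨β, hβ⟩ : ∃ β, β = (a + b) / 2 := ⟨_, rfl⟩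
  have hα0 : α ≠ 0 := by
    rw [hα]; exact div_ne_zero (sub_ne_zero.mpr hab) two_ne_zero
  obtain rfl : a = α + β := by linear_combination -hα - hβ
  obtain rfl : b = β - α := by linear_combination hα - hβ
  clear hα hβ
  obtain ⟨L, hL⟩ : ∃ L : ℂ[X], L = C α * X + C β := ⟨_, rfl⟩
  obtain ⟨B, hB⟩ : ∃ B : ℂ[X], B = C α⁻¹ * (P.comp L - C β) := ⟨_, rfl⟩
  have hPB : P.comp L = C α * B + C β := by
    rw [hB, ← mul_assoc, ← C_mul, mul_inv_cancel₀ hα0]; simp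
  have hdeg : B.natDegree = P.natDegree := by
    rw [hB, natDegree_C_mul (inv_ne_zero hα0), natDegree_sub_C, natDegree_comp, hL,
      natDegree_linear hα0, mul_one]
  have hder : (derivative P).comp L = derivative B := by
    have h1 := congrArg derivative hPB
    rw [derivative_comp, hL] at h1
    simp only [derivative_add, derivative_mul, derivative_C, derivative_X, zero_mul, mul_one,
      zero_add, add_zero] at h1
    rw [← hL] at h1
    exact mul_left_cancel₀ (C_ne_zero.mpr hα0) h1
  have hpell : C c * (B ^ 2 - 1) = derivative B ^ 2 * (X ^ 2 - 1) := by
    have h1 := congrArg (fun p => p.comp L) h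
    simp only [mul_comp, sub_comp, C_comp, X_comp, pow_comp, hder, hPB] at h1
    rw [hL] at h1
    apply mul_left_cancel₀ (pow_ne_zero 2 (C_ne_zero.mpr hα0))
    simp only [C_add, C_sub] at h1
    linear_combination h1
  rw [hL] at hPB
  rcases eq_T_or_neg_T (hdeg ▸ hP) hc hpell with h1 | h1 <;> rw [hdeg] at h1
  · left; rw [h1] at hPB; exact conjugate_of_affine hα0 hPB
  · right; rw [h1] at hPB; exact conjugate_of_affine hα0 hPB

lemma prod_sub_C_dvd {P : ℂ[X]} (hP : P.natDegree ≠ 0) (S : Finset ℂ)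
    (hS : ∀ z, P.eval z ∈ S → z ∉ S → 2 ≤ rootMultiplicity z (P - C (P.eval z))) :
    ∏ w ∈ S, (P - C w) ∣ derivative P ^ 2 * ∏ w ∈ S, (X - C w) := by
  have h0 : ∀ w, P - C w ≠ 0 := by
    intro w h
    rw [sub_eq_zero.mp h] at hP
    simp at hP
  have hP' : derivative P ≠ 0 := fun h0 => hP (derivative_eq_zero.mp h0)
  have hF0 : ∏ w ∈ S, (P - C w) ≠ 0 := Finset.prod_ne_zero_iff.mpr fun w _ => h0 w
  have hX0 : ∏ w ∈ S, (X - C w) ≠ 0 := Finset.prod_ne_zero_iff.mpr fun w _ => X_sub_C_ne_zero w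
  have hG0 : derivative P ^ 2 * ∏ w ∈ S, (X - C w) ≠ 0 := mul_ne_zero (pow_ne_zero 2 hP') hX0
  rw [IsAlgClosed.dvd_iff_roots_le_roots hF0 hG0, Multiset.le_iff_count]
  intro z
  rw [count_roots, count_roots]
  by_cases hz : P.eval z ∈ S
  · have hF : rootMultiplicity z (∏ w ∈ S, (P - C w)) =
        rootMultiplicity z (P - C (P.eval z)) := by
      rw [← Finset.mul_prod_erase S _ hz] at hF0 ⊢
      rw [rootMultiplicity_mul hF0, Nat.add_eq_left]
      apply rootMultiplicity_eq_zero
      rw [IsRoot, eval_prod, Finset.prod_eq_zero_iff]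
      rintro ⟨w, hw, h1⟩
      rw [eval_sub, eval_C, sub_eq_zero] at h1
      exact Finset.ne_of_mem_erase hw h1.symm
    have hd : rootMultiplicity z (derivative P) =
        rootMultiplicity z (P - C (P.eval z)) - 1 := by
      rw [← derivative_rootMultiplicity_of_root (by simp)]
      simp
    have he : 1 ≤ rootMultiplicity z (P - C (P.eval z)) := by
      rw [Nat.succ_le_iff, rootMultiplicity_pos (h0 _)]
      simp
    rw [hF, rootMultiplicity_mul hG0, pow_two, rootMultiplicity_mul (mul_ne_zero hP' hP'), hd]
    by_cases hzS : z ∈ S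
    · have : 1 ≤ rootMultiplicity z (∏ w ∈ S, (X - C w)) := by
        rw [Nat.succ_le_iff, rootMultiplicity_pos hX0, IsRoot, eval_prod]
        exact Finset.prod_eq_zero hzS (by simp)
      omega
    · have := hS z hz hzS
      omega
  · rw [rootMultiplicity_eq_zero]
    · exact Nat.zero_le _
    rw [IsRoot, eval_prod, Finset.prod_eq_zero_iff]
    rintro ⟨w, hw, h1⟩
    rw [eval_sub, eval_C, sub_eq_zero] at h1
    exact hz (h1 ▸ hw)

/-- A finite set over which all preimages outside of it are critical has at most two points,
and two points force a Pell-type equation. -/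
lemma card_le_two_and_eq {P : ℂ[X]} (hP : 2 ≤ P.natDegree) (S : Finset ℂ)
    (hS : ∀ z, P.eval z ∈ S → z ∉ S → 2 ≤ rootMultiplicity z (P - C (P.eval z))) :
    S.card ≤ 2 ∧ (S.card = 2 → ∃ c : ℂ, c ≠ 0 ∧
      C c * ∏ w ∈ S, (P - C w) = derivative P ^ 2 * ∏ w ∈ S, (X - C w)) := by
  have hP' : derivative P ≠ 0 := fun h0 => by
    have := derivative_eq_zero.mp h0
    omega
  obtain ⟨k, hk⟩ := prod_sub_C_dvd (by omega) S hS
  have hX0 : ∏ w ∈ S, (X - C w) ≠ 0 := Finset.prod_ne_zero_iff.mpr fun w _ => X_sub_C_ne_zero w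
  have hG0 : derivative P ^ 2 * ∏ w ∈ S, (X - C w) ≠ 0 := mul_ne_zero (pow_ne_zero 2 hP') hX0
  have hk0 : k ≠ 0 := by rintro rfl; simp [hk] at hG0
  have hF0 : ∏ w ∈ S, (P - C w) ≠ 0 := by intro h; simp [hk, h] at hG0
  have hd := congrArg natDegree hk
  rw [natDegree_mul (pow_ne_zero 2 hP') hX0, natDegree_mul hF0 hk0, natDegree_pow,
    natDegree_derivative, natDegree_prod_of_monic _ _ (fun w _ => monic_X_sub_C w),
    natDegree_prod _ _ (fun w hw => (Finset.prod_ne_zero_iff.mp hF0) w hw)] at hd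
  simp only [natDegree_sub_C, natDegree_X, Finset.sum_const, smul_eq_mul, mul_one] at hd
  obtain ⟨e, he⟩ : ∃ e, P.natDegree = e + 2 := ⟨_, (Nat.sub_add_cancel hP).symm⟩
  rw [he] at hd
  constructor
  · by_contra! hlt
    obtain ⟨j, hj⟩ : ∃ j, S.card = j + 3 := ⟨_, (Nat.sub_add_cancel hlt).symm⟩
    rw [hj, show e + 2 - 1 = e + 1 by omega] at hd
    nlinarith
  · intro h2
    rw [h2] at hd
    have hkd : k.natDegree = 0 := by omega
    rw [eq_C_of_natDegree_eq_zero hkd] at hk hk0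
    exact ⟨_, C_ne_zero.mp hk0, by rw [hk, mul_comm]⟩

/-- **Theorem (polynomial generalized Lattès maps).** If a polynomial `A` of degree at
least two is a minimal holomorphic self-map of some nontrivial orbifold on `ℂP¹`, then
either `A` is conjugate to `z^r R(z)^n` for some `n ≥ 2`, `r ≥ 0` with `gcd(r,n) = 1`
and a polynomial `R`, or `A` is conjugate to `T_m` or `-T_m` where `m = deg A`. -/
theorem polynomial_generalized_lattes (P : Polynomial ℂ) (hP : 2 ≤ P.natDegree)
    (O : Orbifold) (hO : O.Good) (hnt : O.IsNontrivial)
    (hmin : IsMinHolo (algebraMap (Polynomial ℂ) (RatFunc ℂ) P) O O) :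
    (∃ (n r : ℕ) (R : Polynomial ℂ), 2 ≤ n ∧ Nat.gcd r n = 1 ∧
      Conjugate (algebraMap (Polynomial ℂ) (RatFunc ℂ) P)
        (RatFunc.X ^ r * (algebraMap (Polynomial ℂ) (RatFunc ℂ) R) ^ n)) ∨
    Conjugate (algebraMap (Polynomial ℂ) (RatFunc ℂ) P)
      (chebyRF (rdeg (algebraMap (Polynomial ℂ) (RatFunc ℂ) P))) ∨
    Conjugate (algebraMap (Polynomial ℂ) (RatFunc ℂ) P)
      (-(chebyRF (rdeg (algebraMap (Polynomial ℂ) (RatFunc ℂ) P)))) := by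
  set S : Finset ℂ := (O.finite.preimage (f := ((↑) : ℂ → OnePoint ℂ))
    (OnePoint.coe_injective.injOn)).toFinset with hSdef
  have hmem : ∀ z : ℂ, z ∈ S ↔ O.nu z ≠ 1 := by intro z; simp [hSdef]
  have hminF : ∀ z : ℂ, O.nu ((P.eval z : ℂ) : OnePoint ℂ) = O.nu z *
      Nat.gcd (rootMultiplicity z (P - Polynomial.C (P.eval z)))
        (O.nu ((P.eval z : ℂ) : OnePoint ℂ)) := by
    intro z
    have h := hmin z
    rwa [evalOP_algebraMap_coe, locDeg_algebraMap_coe] at h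
  have hpos : ∀ z, 0 < O.nu z := O.one_le
  have hdvd : ∀ z, P.eval z ∈ S → z ∉ S → O.nu ((P.eval z : ℂ) : OnePoint ℂ) ∣
      rootMultiplicity z (P - Polynomial.C (P.eval z)) := by
    intro z _ hz
    have h := hminF z
    rw [hmem, not_not] at hz
    rw [hz, one_mul] at h
    exact Nat.gcd_eq_right_iff_dvd.mp h.symm
  have h0 : ∀ w, P - Polynomial.C w ≠ 0 := by
    intro w h
    rw [sub_eq_zero.mp h] at hP
    simp at hP
  have hcrit : ∀ z, P.eval z ∈ S → z ∉ S →
      2 ≤ rootMultiplicity z (P - Polynomial.C (P.eval z)) := by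
    intro z hzS hz
    have h1 := hpos ((P.eval z : ℂ) : OnePoint ℂ)
    have h2 := (hmem _).mp hzS
    have h3 : 0 < rootMultiplicity z (P - Polynomial.C (P.eval z)) := by
      rw [rootMultiplicity_pos (h0 _)]; simp
    have h4 := Nat.le_of_dvd h3 (hdvd z hzS hz)
    omega
  obtain ⟨hcard, htwo⟩ := card_le_two_and_eq hP S hcrit
  have hrdeg : rdeg (algebraMap (Polynomial ℂ) (RatFunc ℂ) P) = P.natDegree := by simp [rdeg]
  have hSpos : S.card ≠ 0 := by
    intro h
    rw [Finset.card_eq_zero] at h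
    have h1 : ∀ z : ℂ, O.nu z = 1 := fun z => by
      have := hmem z
      simpa [h] using this
    obtain ⟨w, hw⟩ := hnt
    refine hO.1 ⟨∞, ?_⟩
    ext x
    induction x using OnePoint.rec with
    | coe z => simp [h1]
    | infty =>
      induction w using OnePoint.rec with
      | coe z => simp [h1] at hw
      | infty => simpa using hw.ne'
  obtain h1 | h2 : S.card = 1 ∨ S.card = 2 := by omega
  · left
    obtain ⟨a, ha⟩ := Finset.card_eq_one.mp h1
    have hna : O.nu a ≠ 1 := (hmem a).mp (by simp [ha])
    have hPa : P.eval a = a := by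
      have h : P.eval a ∈ S := by
        rw [hmem]
        intro h
        exact hna (Nat.dvd_one.mp (h ▸ Dvd.intro _ (hminF a).symm))
      simpa [ha] using h
    have hcop : Nat.gcd (rootMultiplicity a (P - Polynomial.C a)) (O.nu a) = 1 := by
      have h := hminF a
      rw [hPa] at h
      exact Nat.eq_of_mul_eq_mul_left (hpos a) (by rw [← h, mul_one])
    obtain ⟨r, R, hr, hconj⟩ := exists_conjugate_X_pow_mul_pow (P := P) (by omega)
      (hpos a).ne' hcop (by
        intro z hz
        by_cases hza : P.eval z = a
        · have h := hdvd z (by simp [hza, ha]) (by simp [ha, hz])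
          rwa [hza] at h
        · rw [rootMultiplicity_eq_zero]
          · exact dvd_zero _
          · simpa [sub_eq_zero] using hza)
    have := hpos a
    exact ⟨O.nu a, r, R, by omega, hr, hconj⟩
  · right
    obtain ⟨a, b, hab, hS⟩ := Finset.card_eq_two.mp h2
    obtain ⟨c, hc, h⟩ := htwo h2
    rw [hS, Finset.prod_pair hab, Finset.prod_pair hab] at h
    rw [hrdeg, chebyRF, ← map_neg]
    exact conjugate_T_or_neg_T (by omega) hab hc h

end GenLattes
end
end
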